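/- arXiv:1602.02659 — 2 statements merged into one kernel-verified Lean document; each statement's English description precedes it below -/
import Mathlib

section
/- Let (ω₁,ω₂,ω₃) ∈ ℝ³ be fixed. For every ε > 0 and every s ∈ ℕ there exist an increasing cover (I_n)_{n∈ℤ} = ((a_n,b_n))_{n∈ℤ} of (0,∞) and C^∞ functions f₁, f₂, f₃ : ℝ → ℝ with 0 ≤ f_i < 1, f_i(0) = 0 and ‖f_i‖_s < ε, together with real numbers f̄_{1,n}, f̄_{2,n}, f̄_{3,n} (n ∈ ℤ), such that: for each n ∈ ℤ, f₁ ≡ f̄_{1,n} and f₂ ≡ f̄_{2,n} on I_{3n}; f₁ ≡ f̄_{1,n} and f₃ ≡ f̄_{3,n} on I_{3n+1}; f₂ ≡ f̄_{2,n} and f₃ ≡ f̄_{3,n−1} on I_{3n−1}; and the three vectors (f̄_{1,n}+ω₁, f̄_{2,n}+ω₂), (f̄_{1,n}+ω₁, f̄_{3,n}+ω₃) and (f̄_{2,n}+ω₂, f̄_{3,n}+ω₃) are Liouville vectors in ℝ². Moreover, if ω₁ω₂ < 0, then one can additionally ensure that (ω₁ + f₁(t))(ω₂ + f₂(t)) <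 0 for every t ∈ ℝ. -/
open Filter Topology Set

noncomputable section

/-- A vector `(α, β) ∈ ℝ²` is Diophantine. -/
def IsDiophantinePair (α β : ℝ) : Prop :=
  ∃ γ > (0:ℝ), ∃ N > (0:ℝ), ∀ k : ℤ × ℤ, k ≠ 0 →
    γ * (max |(k.1 : ℝ)| |(k.2 : ℝ)|) ^ (-N) ≤ |(k.1 : ℝ) * α + (k.2 : ℝ) * β|

/-- A vector `(α, β) ∈ ℝ²` is Liouville: non-resonant but not Diophantine. -/
def IsLiouvillePair (α β : ℝ) : Prop :=
  (∀ k : ℤ × ℤ, k ≠ 0 → (k.1 : ℝ) * α + (k.2 : ℝ) * β ≠ 0) ∧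
  ¬ IsDiophantinePair α β

/-- `(I_n) = ((a_n, b_n))_{n ∈ ℤ}` is an increasing cover of `(0, ∞)`. -/
structure IsIncreasingCover (a b : ℤ → ℝ) : Prop where
  pos : ∀ n, 0 < a n
  lt : ∀ n, a n < b n
  left_le : ∀ n, a n ≤ b (n - 1)
  mid_lt : ∀ n, b (n - 1) < a (n + 1)
  right_le : ∀ n, a (n + 1) ≤ b n
  tendsto_zero : Tendsto a atBot (𝓝 0)
  tendsto_top : Tendsto a atTop atTop

theorem exists_flat_plateau_function {κ η : ℝ} (hκ : 0 < κ) (hη : 0 < η) (s : ℕ) :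
    ∃ δ : ℤ → ℝ, (∀ n, 0 < δ n) ∧ ∀ c : ℤ → ℝ, (∀ n, 0 ≤ c n) → (∀ n, c n ≤ δ n) →
      ∃ f : ℝ → ℝ, ContDiff ℝ (⊤ : ℕ∞) f ∧ (∀ t, 0 ≤ f t) ∧ f 0 = 0 ∧
        (∀ k ≤ s, ∀ t, |iteratedDeriv k f t| < η) ∧
        ∀ n, ∀ t ∈ Icc (κ * 8 ^ n) (4 * κ * 8 ^ n), f t = c n := by
  have h8 : ∀ n : ℤ, (0 : ℝ) < κ * 8 ^ n := fun n => by positivity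
  have hstep : ∀ m n : ℤ, m < n → 8 * (κ * 8 ^ m) ≤ κ * 8 ^ n := fun m n h => by
    have : (8 : ℝ) ^ (m + 1) ≤ 8 ^ n := zpow_le_zpow_right₀ (by norm_num) h
    rw [zpow_add_one₀ (by norm_num)] at this
    nlinarith
  let φ : ∀ n : ℤ, ContDiffBump (5 / 2 * (κ * 8 ^ n) : ℝ) := fun n =>
    ⟨3 / 2 * (κ * 8 ^ n), 2 * (κ * 8 ^ n), by linarith [h8 n], by linarith [h8 n]⟩
  have hφ_one : ∀ n t, t ∈ Icc (κ * 8 ^ n) (4 * κ * 8 ^ n) → φ n t = 1 := fun n t ht => by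
    apply (φ n).one_of_mem_closedBall
    rw [Metric.mem_closedBall, Real.dist_eq, abs_le]
    change -(3 / 2 * (κ * 8 ^ n)) ≤ _ ∧ _ ≤ 3 / 2 * (κ * 8 ^ n)
    constructor <;> linarith [ht.1, ht.2]
  have hφ_left : ∀ n t, t ≤ κ * 8 ^ n / 2 → φ n t = 0 := fun n t ht => by
    apply (φ n).zero_of_le_dist
    rw [Real.dist_eq]
    change 2 * (κ * 8 ^ n) ≤ _
    rw [le_abs]; right; linarith
  have hφ_right : ∀ n t, 9 / 2 * (κ * 8 ^ n) ≤ t → φ n t = 0 := fun n t ht => by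
    apply (φ n).zero_of_le_dist
    rw [Real.dist_eq]
    change 2 * (κ * 8 ^ n) ≤ _
    rw [le_abs]; left; linarith
  have hbound : ∀ (k : ℕ) (n : ℤ), ∃ C, ∀ t, ‖iteratedFDeriv ℝ k (φ n) t‖ ≤ C := fun k n =>
    ((φ n).hasCompactSupport.iteratedFDeriv k).exists_bound_of_continuous
      ((φ n).contDiff.continuous_iteratedFDeriv (n := (k : ℕ∞)) (by exact_mod_cast le_rfl))
  choose B hB using hbound
  have hB0 : ∀ k n, 0 ≤ B k n := fun k n => (norm_nonneg _).trans (hB k n 0)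
  obtain ⟨e, he, S, hS, hSη⟩ := posSumOfEncodable (half_pos hη) ℤ
  have hT : ∀ n : ℤ, 0 < 1 + ∑ k ∈ Finset.range (n.natAbs + s + 1), B k n := fun n => by
    have := Finset.sum_nonneg fun k (_ : k ∈ Finset.range (n.natAbs + s + 1)) => hB0 k n
    linarith
  refine ⟨fun n => e n / (1 + ∑ k ∈ Finset.range (n.natAbs + s + 1), B k n),
    fun n => div_pos (he n) (hT n), fun c hc0 hc => ?_⟩
  have hv : ∀ (k : ℕ) (n : ℤ), k ≤ n.natAbs + s → c n * B k n ≤ e n := fun k n hk => by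
    have h1 : B k n ≤ 1 + ∑ k ∈ Finset.range (n.natAbs + s + 1), B k n := by
      have := Finset.single_le_sum (fun k _ => hB0 k n)
        (Finset.mem_range.2 (Nat.lt_succ_of_le hk))
      linarith
    calc c n * B k n ≤ c n * (1 + ∑ k ∈ Finset.range (n.natAbs + s + 1), B k n) :=
          mul_le_mul_of_nonneg_left h1 (hc0 n)
      _ ≤ e n := (le_div_iff₀ (hT n)).1 (hc n)
  have hvsum : ∀ k : ℕ, Summable fun n => c n * B k n := fun k => by
    refine Summable.of_norm_bounded_eventually hS.summable ?_
    have hfin : {n : ℤ | n.natAbs < k}.Finite :=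
      (Set.finite_Icc (-(k : ℤ)) k).subset fun n hn => by
        simp only [mem_ofPred_eq] at hn; simp only [mem_Icc]; omega
    filter_upwards [hfin.compl_mem_cofinite] with n hn
    rw [Real.norm_of_nonneg (mul_nonneg (hc0 n) (hB0 k n))]
    simp only [mem_compl_iff, mem_ofPred_eq] at hn
    exact hv k n (by omega)
  have hterm : ∀ n, ContDiff ℝ (⊤ : ℕ∞) fun t => c n * φ n t := fun n =>
    contDiff_const.mul (φ n).contDiff
  have hder : ∀ (k : ℕ) (n : ℤ) (t : ℝ),
      ‖iteratedFDeriv ℝ k (fun t => c n * φ n t) t‖ ≤ c n * B k n := fun k n t => by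
    have : (fun t => c n * φ n t) = c n • (φ n : ℝ → ℝ) := rfl
    rw [this, iteratedFDeriv_const_smul_apply ((φ n).contDiff.contDiffAt), norm_smul,
      Real.norm_of_nonneg (hc0 n)]
    exact mul_le_mul_of_nonneg_left (hB k n t) (hc0 n)
  refine ⟨fun t => ∑' n, c n * φ n t, ?_, ?_, ?_, ?_, ?_⟩
  · exact contDiff_tsum hterm (fun k _ => hvsum k) fun k n t _ => hder k n t
  · exact fun t => tsum_nonneg fun n => mul_nonneg (hc0 n) (φ n).nonneg
  · have : ∀ n, c n * φ n 0 = 0 := fun n => by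
      rw [hφ_left n 0 (by linarith [h8 n]), mul_zero]
    simp only [this, tsum_zero]
  · intro k hk t
    rw [← Real.norm_eq_abs, ← norm_iteratedFDeriv_eq_norm_iteratedDeriv,
      iteratedFDeriv_tsum (N := ⊤) hterm (fun k _ => hvsum k) (fun k n t _ => hder k n t) le_top]
    exact (tsum_of_norm_bounded hS fun n =>
      (hder k n t).trans (hv k n (by omega))) |>.trans_lt (by linarith)
  · intro n t ht
    change ∑' m, c m * φ m t = c n
    rw [tsum_eq_single n, hφ_one n t ht, mul_one]
    intro m hm
    rcases lt_or_gt_of_ne hm with h | h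
    · rw [hφ_right m t, mul_zero]
      linarith [hstep m n h, ht.1, h8 m]
    · rw [hφ_left m t, mul_zero]
      linarith [hstep n m h, ht.2, h8 m]

theorem dense_setOf_resonance_ne_zero {k : ℤ × ℤ} (hk : k ≠ 0) :
    Dense {p : ℝ × ℝ | (k.1 : ℝ) * p.1 + (k.2 : ℝ) * p.2 ≠ 0} := by
  rw [Metric.dense_iff]
  intro p r hr
  by_cases hp : (k.1 : ℝ) * p.1 + (k.2 : ℝ) * p.2 = 0
  · have hmem : ∀ x y : ℝ, |x| < r → |y| < r → (p.1 + x, p.2 + y) ∈ Metric.ball p r :=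
      fun x y hx hy => by
        rw [Metric.mem_ball, Prod.dist_eq, Real.dist_eq, Real.dist_eq]
        simp [hx, hy]
    have hr2 : |r / 2| < r := by rw [abs_of_pos (by linarith)]; linarith
    have h0 : |(0 : ℝ)| < r := by simpa using hr
    by_cases h1 : k.1 = 0
    · have h2 : (k.2 : ℝ) ≠ 0 := by
        exact_mod_cast fun h2 => hk (Prod.ext h1 h2)
      refine ⟨_, hmem 0 (r / 2) h0 hr2, ?_⟩
      change (k.1 : ℝ) * (p.1 + 0) + (k.2 : ℝ) * (p.2 + r / 2) ≠ 0
      have : (k.2 : ℝ) * (r / 2) ≠ 0 := mul_ne_zero h2 (by positivity)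
      intro h; apply this; linarith
    · have h1 : (k.1 : ℝ) ≠ 0 := by exact_mod_cast h1
      refine ⟨_, hmem (r / 2) 0 hr2 h0, ?_⟩
      change (k.1 : ℝ) * (p.1 + r / 2) + (k.2 : ℝ) * (p.2 + 0) ≠ 0
      have : (k.1 : ℝ) * (r / 2) ≠ 0 := mul_ne_zero h1 (by positivity)
      intro h; apply this; linarith
  · exact ⟨p, Metric.mem_ball_self hr, hp⟩

theorem one_le_max_abs_intCast {k : ℤ × ℤ} (hk : k ≠ 0) :
    1 ≤ max |(k.1 : ℝ)| |(k.2 : ℝ)| := by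
  by_cases h1 : k.1 = 0
  · have h2 : k.2 ≠ 0 := fun h2 => hk (Prod.ext h1 h2)
    exact le_max_of_le_right (by exact_mod_cast Int.one_le_abs h2)
  · exact le_max_of_le_left (by exact_mod_cast Int.one_le_abs h1)

/-- The pairs that admit an approximate resonance of order `m`. -/
def approxResonant (m : ℕ) : Set (ℝ × ℝ) :=
  {p | ∃ k : ℤ × ℤ, k ≠ 0 ∧ |(k.1 : ℝ) * p.1 + (k.2 : ℝ) * p.2| <
    1 / (m + 1) * (max |(k.1 : ℝ)| |(k.2 : ℝ)|) ^ (-(m : ℝ))}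

theorem isOpen_approxResonant (m : ℕ) : IsOpen (approxResonant m) := by
  have : approxResonant m = ⋃ k : ℤ × ℤ, {p : ℝ × ℝ | k ≠ 0 ∧
      |(k.1 : ℝ) * p.1 + (k.2 : ℝ) * p.2| <
        1 / (m + 1) * (max |(k.1 : ℝ)| |(k.2 : ℝ)|) ^ (-(m : ℝ))} := by
    ext p; simp [approxResonant]
  rw [this]
  exact isOpen_iUnion fun k => isOpen_const.and (isOpen_lt (by fun_prop) continuous_const)

theorem dense_approxResonant (m : ℕ) : Dense (approxResonant m) := by
  have hd : Dense (range fun q : ℚ × ℚ => ((q.1 : ℝ), (q.2 : ℝ))) :=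
    (Rat.denseRange_cast (𝕜 := ℝ)).prodMap (Rat.denseRange_cast (𝕜 := ℝ))
  refine hd.mono ?_
  rintro _ ⟨⟨x, y⟩, rfl⟩
  have key : ∀ k : ℤ × ℤ, k ≠ 0 → (k.1 : ℝ) * x + (k.2 : ℝ) * y = 0 →
      ((x : ℝ), (y : ℝ)) ∈ approxResonant m := fun k hk h => by
    refine ⟨k, hk, ?_⟩
    have := one_le_max_abs_intCast hk
    change |(k.1 : ℝ) * x + (k.2 : ℝ) * y| < _
    rw [h, abs_zero]
    positivity
  by_cases hx : x = 0
  · exact key (1, 0) (by simp) (by simp [hx])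
  · refine key (y.num * x.den, -(x.num * y.den)) ?_ ?_
    · intro h
      have h2 := congrArg Prod.snd h
      simp [hx] at h2
    · have e1 : (x.num : ℝ) = x * x.den := by exact_mod_cast (Rat.mul_den_eq_num x).symm
      have e2 : (y.num : ℝ) = y * y.den := by exact_mod_cast (Rat.mul_den_eq_num y).symm
      push_cast
      rw [e1, e2]
      ring

theorem isLiouvillePair_of_forall_mem {p : ℝ × ℝ}
    (h1 : ∀ k : ℤ × ℤ, k ≠ 0 → (k.1 : ℝ) * p.1 + (k.2 : ℝ) * p.2 ≠ 0)
    (h2 : ∀ m, p ∈ approxResonant m) : IsLiouvillePair p.1 p.2 := by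
  refine ⟨h1, ?_⟩
  rintro ⟨γ, hγ, N, -, hD⟩
  obtain ⟨m₁, hm₁⟩ := exists_nat_one_div_lt hγ
  obtain ⟨m₂, hm₂⟩ := exists_nat_ge N
  obtain ⟨k, hk, hlt⟩ := h2 (max m₁ m₂)
  refine absurd (hD k hk) (not_le.2 (hlt.trans_le ?_))
  have hm := one_le_max_abs_intCast hk
  refine mul_le_mul ?_ (Real.rpow_le_rpow_of_exponent_le hm ?_) (by positivity) hγ.le
  · refine le_trans ?_ hm₁.le
    apply one_div_le_one_div_of_le (by positivity)
    push_cast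
    linarith [le_max_left (m₁ : ℝ) m₂]
  · push_cast
    linarith [le_max_right (m₁ : ℝ) m₂]

theorem setOf_isLiouvillePair_mem_residual :
    {p : ℝ × ℝ | IsLiouvillePair p.1 p.2} ∈ residual (ℝ × ℝ) := by
  have h1 : ∀ᶠ p in residual (ℝ × ℝ), ∀ k : ℤ × ℤ, k ≠ 0 →
      (k.1 : ℝ) * p.1 + (k.2 : ℝ) * p.2 ≠ 0 := by
    refine eventually_countable_forall.2 fun k => ?_
    by_cases hk : k = 0
    · simp [hk]
    · filter_upwards [residual_of_dense_open (isOpen_ne_fun (by fun_prop) continuous_const)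
        (dense_setOf_resonance_ne_zero hk)] with p hp _ using hp
  have h2 : ∀ᶠ p in residual (ℝ × ℝ), ∀ m, p ∈ approxResonant m :=
    eventually_countable_forall.2 fun m =>
      residual_of_dense_open (isOpen_approxResonant m) (dense_approxResonant m)
  filter_upwards [h1, h2] with p hp1 hp2 using isLiouvillePair_of_forall_mem hp1 hp2

theorem exists_small_isLiouvillePair_triple (ω₁ ω₂ ω₃ : ℝ) {δ : ℝ} (hδ : 0 < δ) :
    ∃ c₁ ∈ Ioo 0 δ, ∃ c₂ ∈ Ioo 0 δ, ∃ c₃ ∈ Ioo 0 δ,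
      IsLiouvillePair (c₁ + ω₁) (c₂ + ω₂) ∧ IsLiouvillePair (c₁ + ω₁) (c₃ + ω₃) ∧
        IsLiouvillePair (c₂ + ω₂) (c₃ + ω₃) := by
  have pull : ∀ g : ℝ × ℝ × ℝ → ℝ × ℝ, Continuous g → IsOpenMap g →
      ∀ᶠ x in residual (ℝ × ℝ × ℝ), IsLiouvillePair (g x).1 (g x).2 := fun g hg ho =>
    (tendsto_residual_of_isOpenMap hg ho) setOf_isLiouvillePair_mem_residual
  have h12 := pull (fun x => (x.1 + ω₁, x.2.1 + ω₂)) (by fun_prop)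
    ((Homeomorph.addRight ω₁).isOpenMap.prodMap
      ((Homeomorph.addRight ω₂).isOpenMap.comp isOpenMap_fst))
  have h13 := pull (fun x => (x.1 + ω₁, x.2.2 + ω₃)) (by fun_prop)
    ((Homeomorph.addRight ω₁).isOpenMap.prodMap
      ((Homeomorph.addRight ω₃).isOpenMap.comp isOpenMap_snd))
  have h23 := pull (fun x => (x.2.1 + ω₂, x.2.2 + ω₃)) (by fun_prop)
    (((Homeomorph.addRight ω₂).isOpenMap.prodMap
      (Homeomorph.addRight ω₃).isOpenMap).comp isOpenMap_snd)
  have hd := dense_of_mem_residual (h12.and (h13.and h23))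
  obtain ⟨x, ⟨hx1, hx2, hx3⟩, hx⟩ := hd.inter_open_nonempty
    (Ioo 0 δ ×ˢ Ioo 0 δ ×ˢ Ioo 0 δ) (isOpen_Ioo.prod (isOpen_Ioo.prod isOpen_Ioo))
    ⟨(δ / 2, δ / 2, δ / 2), by simp [hδ]⟩
  exact ⟨x.1, hx1, x.2.1, hx2, x.2.2, hx3, hx.1, hx.2.1, hx.2.2⟩

theorem tendsto_two_zpow_atTop : Tendsto (fun n : ℤ => (2 : ℝ) ^ n) atTop atTop := by
  refine tendsto_atTop_mono' _ ?_ (tendsto_intCast_atTop_atTop (R := ℝ))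
  filter_upwards [eventually_ge_atTop 0] with n hn
  lift n to ℕ using hn
  exact_mod_cast Nat.lt_two_pow_self.le

theorem isIncreasingCover_two_zpow :
    IsIncreasingCover (fun n => 2 ^ n) (fun n => 2 ^ (n + 1)) where
  pos n := by positivity
  lt n := zpow_lt_zpow_right₀ (by norm_num) (by omega)
  left_le n := by simp
  mid_lt n := zpow_lt_zpow_right₀ (by norm_num) (by omega)
  right_le n := le_rfl
  tendsto_zero := by
    refine (tendsto_two_zpow_atTop.comp tendsto_neg_atBot_atTop).inv_tendsto_atTop.congr
      fun n => ?_
    simp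
  tendsto_top := tendsto_two_zpow_atTop

theorem statement6 (ω₁ ω₂ ω₃ : ℝ) (ε : ℝ) (hε : 0 < ε) (s : ℕ) :
    ∃ a b : ℤ → ℝ, IsIncreasingCover a b ∧
    ∃ f₁ f₂ f₃ : ℝ → ℝ, ∃ c₁ c₂ c₃ : ℤ → ℝ,
      (ContDiff ℝ (⊤ : ℕ∞) f₁ ∧ ContDiff ℝ (⊤ : ℕ∞) f₂ ∧ ContDiff ℝ (⊤ : ℕ∞) f₃) ∧
      (∀ t : ℝ, (0 ≤ f₁ t ∧ f₁ t < 1) ∧ (0 ≤ f₂ t ∧ f₂ t < 1) ∧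
        (0 ≤ f₃ t ∧ f₃ t < 1)) ∧
      (f₁ 0 = 0 ∧ f₂ 0 = 0 ∧ f₃ 0 = 0) ∧
      (∀ k ≤ s, ∀ t : ℝ, |iteratedDeriv k f₁ t| < ε ∧
        |iteratedDeriv k f₂ t| < ε ∧ |iteratedDeriv k f₃ t| < ε) ∧
      (∀ n : ℤ,
        (∀ t ∈ Ioo (a (3 * n)) (b (3 * n)), f₁ t = c₁ n ∧ f₂ t = c₂ n) ∧
        (∀ t ∈ Ioo (a (3 * n + 1)) (b (3 * n + 1)), f₁ t = c₁ n ∧ f₃ t = c₃ n) ∧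
        (∀ t ∈ Ioo (a (3 * n - 1)) (b (3 * n - 1)), f₂ t = c₂ n ∧ f₃ t = c₃ (n - 1)) ∧
        IsLiouvillePair (c₁ n + ω₁) (c₂ n + ω₂) ∧
        IsLiouvillePair (c₁ n + ω₁) (c₃ n + ω₃) ∧
        IsLiouvillePair (c₂ n + ω₂) (c₃ n + ω₃)) ∧
      (ω₁ * ω₂ < 0 → ∀ t : ℝ, (ω₁ + f₁ t) * (ω₂ + f₂ t) < 0) := by
  obtain ⟨η, hη, hηε, hη1, hηω⟩ : ∃ η > 0, η ≤ ε ∧ η ≤ 1 ∧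
      (ω₁ * ω₂ < 0 → η ≤ |ω₁| ∧ η ≤ |ω₂|) := by
    by_cases h : ω₁ * ω₂ < 0
    · have h1 : ω₁ ≠ 0 := by rintro rfl; simp at h
      have h2 : ω₂ ≠ 0 := by rintro rfl; simp at h
      exact ⟨min (min ε 1) (min |ω₁| |ω₂|), by positivity, by simp, by simp, by simp⟩
    · exact ⟨min ε 1, by positivity, by simp, by simp, fun h' => absurd h' h⟩
  obtain ⟨δ₁, hδ₁, H₁⟩ := exists_flat_plateau_function one_pos hη s
  obtain ⟨δ₂, hδ₂, H₂⟩ := exists_flat_plateau_function one_half_pos hη s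
  obtain ⟨δ₃, hδ₃, H₃⟩ := exists_flat_plateau_function two_pos hη s
  choose c₁ hc₁ c₂ hc₂ c₃ hc₃ hL₁₂ hL₁₃ hL₂₃ using fun n =>
    exists_small_isLiouvillePair_triple ω₁ ω₂ ω₃
      (lt_min (hδ₁ n) (lt_min (hδ₂ n) (hδ₃ n)))
  obtain ⟨f₁, hf₁, hf₁0, hf₁z, hf₁s, hf₁c⟩ := H₁ c₁ (fun n => (hc₁ n).1.le)
    fun n => ((hc₁ n).2.le.trans (min_le_left _ _))
  obtain ⟨f₂, hf₂, hf₂0, hf₂z, hf₂s, hf₂c⟩ := H₂ c₂ (fun n => (hc₂ n).1.le)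
    fun n => ((hc₂ n).2.le.trans ((min_le_right _ _).trans (min_le_left _ _)))
  obtain ⟨f₃, hf₃, hf₃0, hf₃z, hf₃s, hf₃c⟩ := H₃ c₃ (fun n => (hc₃ n).1.le)
    fun n => ((hc₃ n).2.le.trans ((min_le_right _ _).trans (min_le_right _ _)))
  have lt_η : ∀ f : ℝ → ℝ, (∀ k ≤ s, ∀ t, |iteratedDeriv k f t| < η) → ∀ t, f t < η :=
    fun f hf t => (le_abs_self _).trans_lt (by simpa using hf 0 (Nat.zero_le s) t)
  have h₁η := lt_η f₁ hf₁s
  have h₂η := lt_η f₂ hf₂s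
  have h₃η := lt_η f₃ hf₃s
  refine ⟨_, _, isIncreasingCover_two_zpow, f₁, f₂, f₃, c₁, c₂, c₃, ⟨hf₁, hf₂, hf₃⟩,
    fun t => ⟨⟨hf₁0 t, (h₁η t).trans_le hη1⟩, ⟨hf₂0 t, (h₂η t).trans_le hη1⟩,
      ⟨hf₃0 t, (h₃η t).trans_le hη1⟩⟩, ⟨hf₁z, hf₂z, hf₃z⟩,
    fun k hk t => ⟨(hf₁s k hk t).trans_le hηε, (hf₂s k hk t).trans_le hηε,
      (hf₃s k hk t).trans_le hηε⟩, fun n => ?_, fun h t => ?_⟩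
  · have two_ne : (2 : ℝ) ≠ 0 := two_ne_zero
    have e0 : (2 : ℝ) ^ (3 * n) = 8 ^ n := by rw [zpow_mul]; norm_num
    have e1 : (2 : ℝ) ^ (3 * n + 1) = 2 * 8 ^ n := by rw [zpow_add_one₀ two_ne, e0, mul_comm]
    have e2 : (2 : ℝ) ^ (3 * n + 1 + 1) = 4 * 8 ^ n := by
      rw [zpow_add_one₀ two_ne, e1]; ring
    have em : (2 : ℝ) ^ (3 * n - 1) = 8 ^ n / 2 := by rw [zpow_sub_one₀ two_ne, e0]; rfl
    have em' : (2 : ℝ) ^ (3 * n - 1 + 1) = 8 ^ n := by rw [sub_add_cancel, e0]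
    have e8 : (8 : ℝ) ^ (n - 1) = 8 ^ n / 8 := by rw [zpow_sub_one₀ (by norm_num)]; rfl
    have hpos : (0 : ℝ) < 8 ^ n := by positivity
    simp only [e0, e1, e2, em, em']
    refine ⟨fun t ht => ⟨hf₁c n t ⟨?_, ?_⟩, hf₂c n t ⟨?_, ?_⟩⟩,
      fun t ht => ⟨hf₁c n t ⟨?_, ?_⟩, hf₃c n t ⟨?_, ?_⟩⟩,
      fun t ht => ⟨hf₂c n t ⟨?_, ?_⟩, hf₃c (n - 1) t ⟨?_, ?_⟩⟩,
      hL₁₂ n, hL₁₃ n, hL₂₃ n⟩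
    all_goals linarith [ht.1, ht.2]
  · obtain ⟨h1, h2⟩ := hηω h
    rcases mul_neg_iff.1 h with ⟨p, q⟩ | ⟨p, q⟩
    · rw [abs_of_neg q] at h2
      exact mul_neg_of_pos_of_neg (by linarith [hf₁0 t]) (by linarith [h₂η t])
    · rw [abs_of_neg p] at h1
      exact mul_neg_of_neg_of_pos (by linarith [h₁η t]) (by linarith [hf₂0 t])
end
end

section
/- Let ω = (ω₁,ω₂) ∈ ℝ² be a Liouville vector and H₀²(p) = ω₁ r₁(p) + ω₂ r₂(p) on ℝ⁴. For any ε > 0, s ∈ ℕ, A₀ > 0, and any symplectomorphism V of ℝ⁴ equal to the identity outside R̃(A₀), and for any A > A₀, there exist a symplectomorphism U of ℝ⁴ with U − Id vanishing to infinite order at every point of {r₁ = 0} ∪ {r₂ = 0}, and a time T > 0, such that, setting H = H₀² ∘ U⁻¹ ∘ V⁻¹: (1) U = Id on the complement of R̃(2A); (2) ‖H − H₀² ∘ V⁻¹‖_s < ε; (3) X_H admits a global flow Φ, and for every P ∈ R̃(A) the orbit segment {Φ(t,P) : t ∈ [0,T]} intersects M(A); (4) if moreover ω₁ω₂ < 0,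 there exists p' ∈ ℝ⁴ such that {Φ(t,p') : t ∈ [0,T]} intersects both {p : r₁(p) < 2A⁻¹ and r₂(p) < 2A⁻¹} and {p : r₁(p) > A} ∪ {p : r₂(p) > A}. -/
open Filter Topology Metric Set

noncomputable section

/-- Phase space `ℝ^d × ℝ^d`, a point is `p = (x, y)`. -/
abbrev Ph (d : ℕ) := (Fin d → ℝ) × (Fin d → ℝ)

/-- Action coordinates `r_j(p) = (x_j² + y_j²)/2`. -/
def actJ {d : ℕ} (j : Fin d) (p : Ph d) : ℝ := (p.1 j ^ 2 + p.2 j ^ 2) / 2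

/-- The Hamiltonian vector field `X_H = (∂H/∂y, -∂H/∂x)`. -/
def hamVF {d : ℕ} (H : Ph d → ℝ) (p : Ph d) : Ph d :=
  (fun j => fderiv ℝ H p (0, Pi.single j 1),
   fun j => - fderiv ℝ H p (Pi.single j 1, 0))

/-- `Φ` is a global flow of the Hamiltonian vector field `X_H`. -/
def IsGlobalFlow {d : ℕ} (H : Ph d → ℝ) (Φ : ℝ → Ph d → Ph d) : Prop :=
  (∀ p, Φ 0 p = p) ∧ (∀ s t p, Φ (s + t) p = Φ s (Φ t p)) ∧
  (∀ p t, HasDerivAt (fun τ => Φ τ p) (hamVF H (Φ t p)) t)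

/-- `H(x,y) = ⟨ω, r(x,y)⟩ + O³(x,y)`: the difference `H - ⟨ω, r⟩` vanishes at the
origin together with its first and second total derivatives. -/
def IsEllipticNF {d : ℕ} (ω : Fin d → ℝ) (H : Ph d → ℝ) : Prop :=
  ∀ k ≤ 2, iteratedFDeriv ℝ k (fun p => H p - ∑ j, ω j * actJ j p) 0 = 0

/-- The standard symplectic form on `ℝ^d × ℝ^d`. -/
def symplForm {d : ℕ} (v w : Ph d) : ℝ :=
  ∑ j, (v.1 j * w.2 j - v.2 j * w.1 j)

/-- `U` is a symplectomorphism of `ℝ^d × ℝ^d` with inverse `Uinv`: a `C^∞`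
diffeomorphism whose derivative at every point preserves the standard
symplectic form. -/
structure IsSymplectomorphism {d : ℕ} (U Uinv : Ph d → Ph d) : Prop where
  smooth : ContDiff ℝ (⊤ : ℕ∞) U
  smooth_inv : ContDiff ℝ (⊤ : ℕ∞) Uinv
  left_inv : Function.LeftInverse Uinv U
  right_inv : Function.RightInverse Uinv U
  sympl : ∀ p v w, symplForm (fderiv ℝ U p v) (fderiv ℝ U p w) = symplForm v w

/-- `U - Id` vanishes to infinite order at every point of `S`. -/
def FlatOn {d : ℕ} (U : Ph d → Ph d) (S : Set (Ph d)) : Prop :=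
  ∀ p ∈ S, ∀ k : ℕ, iteratedFDeriv ℝ k (fun q => U q - q) p = 0

/-- `R̃(A) = {p : r₁(p), r₂(p) ∈ [A⁻¹, A]}`. -/
def Rtilde (A : ℝ) : Set (Ph 2) :=
  {p | actJ 0 p ∈ Icc A⁻¹ A ∧ actJ 1 p ∈ Icc A⁻¹ A}

/-- `M(A) = {r₁ > A} ∪ {r₂ > A} ∪ {r₁ < A⁻¹} ∪ {r₂ < A⁻¹}`. -/
def marginM (A : ℝ) : Set (Ph 2) :=
  {p | A < actJ 0 p} ∪ {p | A < actJ 1 p} ∪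
  {p | actJ 0 p < A⁻¹} ∪ {p | actJ 1 p < A⁻¹}

theorem symplForm_two (v w : Ph 2) : symplForm v w =
    (v.1 0 * w.2 0 - v.2 0 * w.1 0) + (v.1 1 * w.2 1 - v.2 1 * w.1 1) := by
  simp only [symplForm, Fin.sum_univ_two]

theorem symplForm_eq_zero {v : Ph 2} (h : ∀ w, symplForm v w = 0) : v = 0 := by
  have h1 := h (0, Pi.single 0 1)
  have h2 := h (0, Pi.single 1 1)
  have h3 := h (Pi.single 0 1, 0)
  have h4 := h (Pi.single 1 1, 0)
  simp [symplForm_two] at h1 h2 h3 h4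
  ext j <;> fin_cases j <;> simp [h1, h2, h3, h4]

theorem symplForm_sub_left (u v w : Ph 2) :
    symplForm (u - v) w = symplForm u w - symplForm v w := by
  simp [symplForm_two]; ring

theorem symplForm_injective_left {u v : Ph 2} (h : ∀ w, symplForm u w = symplForm v w) :
    u = v := by
  rw [← sub_eq_zero]
  exact symplForm_eq_zero fun w => by rw [symplForm_sub_left, h, sub_self]

theorem injective_of_symplForm {L : Ph 2 →L[ℝ] Ph 2}
    (h : ∀ v w, symplForm (L v) (L w) = symplForm v w) : Function.Injective L := by
  intro u v huv
  refine symplForm_injective_left fun w => ?_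
  rw [← h u, ← h v, huv]

/-- A linear symplectic map as a continuous linear equivalence. -/
def symplEquiv (L : Ph 2 →L[ℝ] Ph 2)
    (h : ∀ v w, symplForm (L v) (L w) = symplForm v w) : Ph 2 ≃L[ℝ] Ph 2 :=
  (LinearEquiv.ofInjectiveEndo (L : Ph 2 →ₗ[ℝ] Ph 2)
    (injective_of_symplForm h)).toContinuousLinearEquiv

theorem coe_symplEquiv (L : Ph 2 →L[ℝ] Ph 2)
    (h : ∀ v w, symplForm (L v) (L w) = symplForm v w) :
    (symplEquiv L h : Ph 2 →L[ℝ] Ph 2) = L := by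
  ext v <;> rfl

theorem symplForm_hamVF (H : Ph 2 → ℝ) (p v : Ph 2) :
    symplForm (hamVF H p) v = fderiv ℝ H p v := by
  have hv : v = v.1 0 • ((Pi.single 0 1, 0) : Ph 2) + v.1 1 • ((Pi.single 1 1, 0) : Ph 2)
      + v.2 0 • ((0, Pi.single 0 1) : Ph 2) + v.2 1 • ((0, Pi.single 1 1) : Ph 2) := by
    ext j <;> fin_cases j <;> simp
  conv_rhs => rw [hv]
  simp only [map_add, map_smul, symplForm_two, hamVF, smul_eq_mul]
  ring

theorem IsSymplectomorphism.comp {U Uinv V Vinv : Ph 2 → Ph 2}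
    (hV : IsSymplectomorphism V Vinv) (hU : IsSymplectomorphism U Uinv) :
    IsSymplectomorphism (fun p => V (U p)) (fun p => Uinv (Vinv p)) where
  smooth := hV.smooth.comp hU.smooth
  smooth_inv := hU.smooth_inv.comp hV.smooth_inv
  left_inv p := by simp only [hV.left_inv _, hU.left_inv _]
  right_inv p := by simp only [hU.right_inv _, hV.right_inv _]
  sympl p v w := by
    have h1 : DifferentiableAt ℝ V (U p) := hV.smooth.differentiable (by simp) _
    have h2 : DifferentiableAt ℝ U p := hU.smooth.differentiable (by simp) _
    have : fderiv ℝ (fun p => V (U p)) p = (fderiv ℝ V (U p)).comp (fderiv ℝ U p) :=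
      fderiv_comp p h1 h2
    rw [this]
    simp only [ContinuousLinearMap.comp_apply]
    rw [hV.sympl, hU.sympl]

theorem hamVF_conj {W Winv : Ph 2 → Ph 2} (hW : IsSymplectomorphism W Winv)
    {H : Ph 2 → ℝ} (hH : Differentiable ℝ H) (p : Ph 2) :
    hamVF (fun q => H (Winv q)) (W p) = fderiv ℝ W p (hamVF H p) := by
  refine symplForm_injective_left fun w => ?_
  have hWd : Differentiable ℝ W := hW.smooth.differentiable (by simp)
  have hWid : Differentiable ℝ Winv := hW.smooth_inv.differentiable (by simp)
  have h1 : (fderiv ℝ W p).comp (fderiv ℝ Winv (W p)) = ContinuousLinearMap.id ℝ _ := by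
    have h3 := fderiv_comp (W p) (f := Winv) (g := W) (hWd _) (hWid _)
    rw [hW.left_inv p] at h3
    rw [← h3]
    have : W ∘ Winv = id := funext hW.right_inv
    rw [this, fderiv_id]
  have h2 : fderiv ℝ (fun q => H (Winv q)) (W p) = (fderiv ℝ H p).comp (fderiv ℝ Winv (W p)) := by
    have h3 := fderiv_comp (W p) (f := Winv) (g := H) (hH _) (hWid _)
    rw [hW.left_inv p] at h3
    exact h3
  rw [symplForm_hamVF, h2]
  have h3 : w = fderiv ℝ W p (fderiv ℝ Winv (W p) w) :=
    (congrArg (fun L => L w) h1).symm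
  conv_rhs => rw [h3, hW.sympl, symplForm_hamVF]
  rfl

theorem IsGlobalFlow.conj {W Winv : Ph 2 → Ph 2} (hW : IsSymplectomorphism W Winv)
    {H : Ph 2 → ℝ} (hH : Differentiable ℝ H) {Φ : ℝ → Ph 2 → Ph 2} (hΦ : IsGlobalFlow H Φ) :
    IsGlobalFlow (fun q => H (Winv q)) (fun t p => W (Φ t (Winv p))) := by
  refine ⟨fun p => ?_, fun s t p => ?_, fun p t => ?_⟩
  · simp only [hΦ.1, hW.right_inv p]
  · simp only [hΦ.2.1, hW.left_inv _]
  · rw [hamVF_conj hW hH]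
    have hWd : Differentiable ℝ W := hW.smooth.differentiable (by simp)
    exact (hWd _).hasFDerivAt.comp_hasDerivAt t (hΦ.2.2 (Winv p) t)

/-- The quadratic Hamiltonian with frequencies `ω₁`, `ω₂`. -/
def quadHam (ω₁ ω₂ : ℝ) (p : Ph 2) : ℝ := ω₁ * actJ 0 p + ω₂ * actJ 1 p

/-- The flow of `quadHam`. -/
def quadFlow (ω₁ ω₂ t : ℝ) (p : Ph 2) : Ph 2 :=
  (![Real.cos (ω₁ * t) * p.1 0 + Real.sin (ω₁ * t) * p.2 0,
     Real.cos (ω₂ * t) * p.1 1 + Real.sin (ω₂ * t) * p.2 1],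
   ![Real.cos (ω₁ * t) * p.2 0 - Real.sin (ω₁ * t) * p.1 0,
     Real.cos (ω₂ * t) * p.2 1 - Real.sin (ω₂ * t) * p.1 1])

theorem contDiff_actJ (j : Fin 2) : ContDiff ℝ (⊤ : ℕ∞) (actJ j : Ph 2 → ℝ) := by
  unfold actJ; fun_prop

theorem contDiff_quadHam (ω₁ ω₂ : ℝ) : ContDiff ℝ (⊤ : ℕ∞) (quadHam ω₁ ω₂) :=
  (contDiff_const.mul (contDiff_actJ 0)).add (contDiff_const.mul (contDiff_actJ 1))

theorem continuous_quadFlow (ω₁ ω₂ : ℝ) :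
    Continuous fun x : ℝ × Ph 2 => quadFlow ω₁ ω₂ x.1 x.2 := by
  unfold quadFlow
  refine Continuous.prodMk (continuous_pi fun j => ?_) (continuous_pi fun j => ?_) <;>
    fin_cases j <;> simp <;> fun_prop

theorem fderiv_apply_eq_of_hasDerivAt {E F : Type*} [NormedAddCommGroup E] [NormedSpace ℝ E]
    [NormedAddCommGroup F] [NormedSpace ℝ F] {f : E → F} {p v : E} {w : F}
    (hf : DifferentiableAt ℝ f p) (h : HasDerivAt (fun t : ℝ => f (p + t • v)) w 0) :
    fderiv ℝ f p v = w := by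
  rw [← h.deriv]
  have := hf.lineDeriv_eq_fderiv (v := v)
  rw [← this]; rfl

theorem fderiv_quadHam (ω₁ ω₂ : ℝ) (p v : Ph 2) : fderiv ℝ (quadHam ω₁ ω₂) p v =
    ω₁ * (p.1 0 * v.1 0 + p.2 0 * v.2 0) + ω₂ * (p.1 1 * v.1 1 + p.2 1 * v.2 1) := by
  refine fderiv_apply_eq_of_hasDerivAt ((contDiff_quadHam ω₁ ω₂).differentiable (by simp) p) ?_
  have h (a b : ℝ) : HasDerivAt (fun t : ℝ => (a + t * b) ^ 2) (2 * a * b) 0 := by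
    have := (((hasDerivAt_id (0 : ℝ)).mul_const b).const_add a).pow 2
    refine this.congr_deriv ?_
    simp
  have := ((((h (p.1 0) (v.1 0)).add (h (p.2 0) (v.2 0))).div_const 2).const_mul ω₁).add
    ((((h (p.1 1) (v.1 1)).add (h (p.2 1) (v.2 1))).div_const 2).const_mul ω₂)
  refine this.congr_deriv ?_
  ring

theorem isGlobalFlow_quadFlow (ω₁ ω₂ : ℝ) :
    IsGlobalFlow (quadHam ω₁ ω₂) (quadFlow ω₁ ω₂) := by
  refine ⟨fun p => ?_, fun s t p => ?_, fun p t => ?_⟩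
  · ext j <;> fin_cases j <;> simp [quadFlow]
  · ext j <;> fin_cases j <;>
      simp [quadFlow, mul_add, Real.cos_add, Real.sin_add] <;> ring
  · have hc (ω : ℝ) : HasDerivAt (fun τ => Real.cos (ω * τ)) (-Real.sin (ω * t) * ω) t := by
      simpa using ((hasDerivAt_id t).const_mul ω).cos
    have hs (ω : ℝ) : HasDerivAt (fun τ => Real.sin (ω * τ)) (Real.cos (ω * t) * ω) t := by
      simpa using ((hasDerivAt_id t).const_mul ω).sin
    refine HasDerivAt.prodMk (hasDerivAt_pi.2 fun j => ?_) (hasDerivAt_pi.2 fun j => ?_)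
    · fin_cases j
      · refine (((hc ω₁).mul_const (p.1 0)).add ((hs ω₁).mul_const (p.2 0))).congr_deriv ?_
        simp [fderiv_quadHam, quadFlow]; ring
      · refine (((hc ω₂).mul_const (p.1 1)).add ((hs ω₂).mul_const (p.2 1))).congr_deriv ?_
        simp [fderiv_quadHam, quadFlow]; ring
    · fin_cases j
      · refine (((hc ω₁).mul_const (p.2 0)).sub ((hs ω₁).mul_const (p.1 0))).congr_deriv ?_
        simp [fderiv_quadHam, quadFlow]; ring
      · refine (((hc ω₂).mul_const (p.2 1)).sub ((hs ω₂).mul_const (p.1 1))).congr_deriv ?_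
        simp [fderiv_quadHam, quadFlow]; ring

theorem Irrational.exists_nonneg_mul_sub_lt {ρ : ℝ} (hρ : Irrational ρ) (x : ℝ) {ε : ℝ}
    (hε : 0 < ε) : ∃ m n : ℤ, 0 ≤ m ∧ |m * ρ - n - x| < ε := by
  have hd : Dense (AddSubgroup.closure {ρ, 1} : Set ℝ) :=
    dense_addSubgroupClosure_pair_iff.2 (by simpa using hρ)
  obtain ⟨y, hy, hxy⟩ := hd.exists_dist_lt x (half_pos hε)
  obtain ⟨m, n, rfl⟩ := AddSubgroup.mem_closure_pair.1 hy
  simp only [zsmul_eq_mul, mul_one] at hxy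
  rw [dist_comm, Real.dist_eq] at hxy
  obtain ⟨N, hN⟩ := exists_nat_gt (|(m : ℝ)| / (ε / 2))
  have hN0 : 0 < N := by
    have : (0 : ℝ) ≤ |(m : ℝ)| / (ε / 2) := by positivity
    exact_mod_cast this.trans_lt hN
  obtain ⟨j, k, hk, -, hkj⟩ := Real.exists_int_int_abs_mul_sub_le ρ hN0
  refine ⟨m + |m| * k, -n + |m| * j, ?_, ?_⟩
  · have h1 : |m| * 1 ≤ |m| * k := mul_le_mul_of_nonneg_left (by omega) (abs_nonneg m)
    have h2 := neg_abs_le m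
    linarith
  · have h1 : |(m : ℝ)| * |k * ρ - j| < ε / 2 := by
      rw [div_lt_iff₀ (half_pos hε)] at hN
      have hN1 : (0 : ℝ) < N + 1 := by positivity
      calc |(m : ℝ)| * |k * ρ - j| ≤ |(m : ℝ)| * (1 / (N + 1)) := by gcongr
        _ < ε / 2 := by
          rw [mul_one_div, div_lt_iff₀ hN1]
          nlinarith
    have h2 : ((m + |m| * k : ℤ) : ℝ) * ρ - ((-n + |m| * j : ℤ) : ℝ) - x =
        (m * ρ + n - x) + |(m : ℝ)| * (k * ρ - j) := by
      push_cast; ring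
    rw [h2]
    refine (abs_add_le _ _).trans_lt ?_
    rw [abs_mul, abs_abs]
    linarith

theorem exists_nonneg_time_near {ω₁ ω₂ : ℝ} (h₁ : ω₁ ≠ 0) (hρ : Irrational (ω₂ / ω₁))
    (a₁ a₂ : ℝ) {ε : ℝ} (hε : 0 < ε) :
    ∃ t : ℝ, 0 ≤ t ∧ ∃ m₁ m₂ : ℤ,
      |ω₁ * t - a₁ - m₁ * (2 * Real.pi)| < ε ∧ |ω₂ * t - a₂ - m₂ * (2 * Real.pi)| < ε := by
  have hpi : 0 < 2 * Real.pi := by positivity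
  obtain ⟨e, he, he1⟩ : ∃ e : ℤ, (e = 1 ∨ e = -1) ∧ 0 < e * ω₁ := by
    rcases lt_or_gt_of_ne h₁ with h | h
    · exact ⟨-1, Or.inr rfl, by push_cast; linarith⟩
    · exact ⟨1, Or.inl rfl, by push_cast; linarith⟩
  have hee : (e : ℝ) * e = 1 := by rcases he with rfl | rfl <;> norm_num
  obtain ⟨M, hM⟩ := exists_nat_gt (|a₁| / (2 * Real.pi))
  have hρ' : Irrational ((e : ℝ) * (ω₂ / ω₁)) := by
    rcases he with rfl | rfl
    · simpa using hρ
    · simpa [neg_div] using hρ.neg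
  obtain ⟨m, n, hm, hmn⟩ := hρ'.exists_nonneg_mul_sub_lt
    ((a₂ - ω₂ / ω₁ * (a₁ + 2 * Real.pi * e * M)) / (2 * Real.pi)) (div_pos hε hpi)
  refine ⟨(a₁ + 2 * Real.pi * e * (m + M)) / ω₁, ?_, e * (m + M), n, ?_, ?_⟩
  · have h2 : (a₁ + 2 * Real.pi * e * (m + M)) / ω₁ =
        (e * a₁ + 2 * Real.pi * (m + M)) / (e * ω₁) := by
      have : (e : ℝ) ≠ 0 := by rcases he with rfl | rfl <;> norm_num
      rw [div_eq_div_iff h₁ (mul_ne_zero this h₁)]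
      linear_combination (2 * Real.pi * ω₁ * (m + M)) * hee
    rw [h2]
    refine div_nonneg ?_ he1.le
    rw [div_lt_iff₀ hpi] at hM
    have h3 : -|a₁| ≤ e * a₁ := by
      have := neg_abs_le ((e : ℝ) * a₁)
      rwa [abs_mul, show |(e : ℝ)| = 1 by rcases he with rfl | rfl <;> norm_num, one_mul] at this
    have h4 : (0 : ℝ) ≤ m := by exact_mod_cast hm
    nlinarith
  · rw [mul_div_cancel₀ _ h₁]
    push_cast
    rw [show a₁ + 2 * Real.pi * e * (m + M) - a₁ - e * (m + M) * (2 * Real.pi) = 0 by ring]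
    simpa using hε
  · rw [lt_div_iff₀ hpi, ← abs_of_pos hpi, ← abs_mul, abs_of_pos hpi] at hmn
    refine lt_of_eq_of_lt (congrArg abs ?_) hmn
    field_simp
    ring

/-- Symplectic polar coordinates: `(r, θ)` is sent to the point with actions `r` and angles `θ`. -/
def polarMap (q : Ph 2) : Ph 2 :=
  (fun j => √(2 * q.1 j) * Real.cos (q.2 j), fun j => √(2 * q.1 j) * Real.sin (q.2 j))

theorem actJ_polarMap {q : Ph 2} {j : Fin 2} (h : 0 ≤ q.1 j) : actJ j (polarMap q) = q.1 j := by
  have h1 := Real.sq_sqrt (show 0 ≤ 2 * q.1 j by linarith)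
  have h2 := Real.sin_sq_add_cos_sq (q.2 j)
  simp only [actJ, polarMap, mul_pow, h1]
  linear_combination q.1 j * h2

theorem polarMap_add_two_pi (q : Ph 2) (m : Fin 2 → ℤ) :
    polarMap (q.1, fun j => q.2 j + m j * (2 * Real.pi)) = polarMap q := by
  simp [polarMap, Real.cos_add_int_mul_two_pi, Real.sin_add_int_mul_two_pi]

/-- A preimage under `polarMap`. -/
def polarSection (p : Ph 2) : Ph 2 :=
  (fun j => actJ j p, fun j => Complex.arg ⟨p.1 j, p.2 j⟩)

theorem polarMap_polarSection (p : Ph 2) : polarMap (polarSection p) = p := by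
  have h (j : Fin 2) : √(2 * actJ j p) = ‖(⟨p.1 j, p.2 j⟩ : ℂ)‖ := by
    rw [Complex.norm_eq_sqrt_sq_add_sq]
    congr 1
    simp only [actJ]; ring
  ext j
  · simp only [polarMap, polarSection, h, Complex.norm_mul_cos_arg]
  · simp only [polarMap, polarSection, h, Complex.norm_mul_sin_arg]

theorem polarSection_polarMap {q : Ph 2} (h : ∀ j, 0 < q.1 j) :
    ∃ m : Fin 2 → ℤ, polarSection (polarMap q) = (q.1, fun j => q.2 j + m j * (2 * Real.pi)) := by
  have (j : Fin 2) : ∃ m : ℤ, Complex.arg ⟨(polarMap q).1 j, (polarMap q).2 j⟩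
      = q.2 j + m * (2 * Real.pi) := by
    have h1 : (⟨(polarMap q).1 j, (polarMap q).2 j⟩ : ℂ) =
        (√(2 * q.1 j) : ℝ) * (Complex.cos (q.2 j : ℝ) + Complex.sin (q.2 j : ℝ) * Complex.I) := by
      rw [← Complex.ofReal_cos, ← Complex.ofReal_sin]
      apply Complex.ext <;> simp [polarMap, Complex.cos_ofReal_re, Complex.sin_ofReal_re]
    have h2 : 0 < √(2 * q.1 j) := Real.sqrt_pos.2 (by linarith [h j])
    rw [h1]
    refine ⟨-toIocDiv Real.two_pi_pos (-Real.pi) (q.2 j), ?_⟩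
    rw [Complex.arg_mul_cos_add_sin_mul_I_eq_toIocMod h2, toIocMod]
    rw [zsmul_eq_mul]; push_cast; ring
  choose m hm using this
  refine ⟨m, Prod.ext ?_ (funext hm)⟩
  ext j
  exact actJ_polarMap (h j).le

/-- The set of points whose two actions are positive. -/
def posAct : Set (Ph 2) := {q | ∀ j, 0 < q.1 j}

theorem isOpen_posAct : IsOpen posAct := by
  have : posAct = {q : Ph 2 | 0 < q.1 0} ∩ {q : Ph 2 | 0 < q.1 1} := by
    ext q; simp [posAct, Fin.forall_fin_two]
  rw [this]
  exact (isOpen_lt (by fun_prop) (by fun_prop)).inter (isOpen_lt (by fun_prop) (by fun_prop))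

theorem contDiffAt_polarMap {q : Ph 2} (h : q ∈ posAct) :
    ContDiffAt ℝ (⊤ : ℕ∞) polarMap q := by
  have h1 (j : Fin 2) : ContDiffAt ℝ (⊤ : ℕ∞) (fun q : Ph 2 => √(2 * q.1 j)) q :=
    ContDiffAt.sqrt (by fun_prop) (by have := h j; positivity)
  exact (contDiffAt_pi.2 fun j => (h1 j).mul (by fun_prop)).prodMk
    (contDiffAt_pi.2 fun j => (h1 j).mul (by fun_prop))

theorem fderiv_polarMap {q : Ph 2} (h : q ∈ posAct) (v : Ph 2) :
    fderiv ℝ polarMap q v =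
      (fun j => v.1 j / √(2 * q.1 j) * Real.cos (q.2 j) -
          √(2 * q.1 j) * Real.sin (q.2 j) * v.2 j,
        fun j => v.1 j / √(2 * q.1 j) * Real.sin (q.2 j) +
          √(2 * q.1 j) * Real.cos (q.2 j) * v.2 j) := by
  refine fderiv_apply_eq_of_hasDerivAt
    ((contDiffAt_polarMap h).differentiableAt (by simp)) ?_
  have ha (j : Fin 2) : HasDerivAt (fun t : ℝ => √(2 * (q.1 j + t * v.1 j)))
      (v.1 j / √(2 * q.1 j)) 0 := by
    have h0 : HasDerivAt (fun t : ℝ => 2 * (q.1 j + t * v.1 j)) (2 * v.1 j) 0 := by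
      simpa using (((hasDerivAt_id (0 : ℝ)).mul_const (v.1 j)).const_add (q.1 j)).const_mul 2
    have hq : 2 * (q.1 j + 0 * v.1 j) ≠ 0 := by have := h j; simp; exact this.ne'
    refine (h0.sqrt hq).congr_deriv ?_
    rw [zero_mul, add_zero, mul_div_mul_left _ _ two_ne_zero]
  have hb (j : Fin 2) : HasDerivAt (fun t : ℝ => q.2 j + t * v.2 j) (v.2 j) 0 := by
    simpa using ((hasDerivAt_id (0 : ℝ)).mul_const (v.2 j)).const_add (q.2 j)
  refine HasDerivAt.prodMk (hasDerivAt_pi.2 fun j => ?_) (hasDerivAt_pi.2 fun j => ?_)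
  · refine ((ha j).mul (hb j).cos).congr_deriv ?_
    simp; ring
  · refine ((ha j).mul (hb j).sin).congr_deriv ?_
    simp; ring

theorem symplForm_fderiv_polarMap {q : Ph 2} (h : q ∈ posAct) (v w : Ph 2) :
    symplForm (fderiv ℝ polarMap q v) (fderiv ℝ polarMap q w) = symplForm v w := by
  rw [fderiv_polarMap h, fderiv_polarMap h]
  simp only [symplForm]
  refine Finset.sum_congr rfl fun j _ => ?_
  have h1 : √(2 * q.1 j) ≠ 0 := (Real.sqrt_pos.2 (by have := h j; linarith)).ne'
  have h2 := Real.sin_sq_add_cos_sq (q.2 j)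
  field_simp
  linear_combination √(2 * q.1 j) ^ 2 * (v.1 j * w.2 j - v.2 j * w.1 j) * h2

theorem exists_local_polarSection {q : Ph 2} (h : q ∈ posAct) :
    ∃ g : Ph 2 → Ph 2, g (polarMap q) = q ∧ ContDiffAt ℝ (⊤ : ℕ∞) g (polarMap q) ∧
      ∀ᶠ p in 𝓝 (polarMap q), polarMap (g p) = p := by
  have h1 := contDiffAt_polarMap h
  have h2 : HasFDerivAt polarMap
      (symplEquiv (fderiv ℝ polarMap q) (symplForm_fderiv_polarMap h) : Ph 2 →L[ℝ] Ph 2) q := by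
    rw [coe_symplEquiv]
    exact (h1.differentiableAt (by simp)).hasFDerivAt
  have hn : ((⊤ : ℕ∞) : WithTop ℕ∞) ≠ 0 := by simp
  refine ⟨h1.localInverse h2 hn, h1.localInverse_apply_image h2 hn, h1.to_localInverse h2 hn, ?_⟩
  exact (h1.hasStrictFDerivAt' h2 hn).eventually_right_inverse

/-- Angle translations by multiples of `2π`. -/
def angleShift (m : Fin 2 → ℤ) (q : Ph 2) : Ph 2 := (q.1, fun j => q.2 j + m j * (2 * Real.pi))

theorem polarMap_angleShift (m : Fin 2 → ℤ) (q : Ph 2) :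
    polarMap (angleShift m q) = polarMap q := polarMap_add_two_pi q m

/-- A map of action-angle space that is `2π`-equivariant in the angles and the identity
when the actions lie outside `[B⁻¹, B]²`. -/
structure IsLiftable (B : ℝ) (F : Ph 2 → Ph 2) : Prop where
  smooth : ContDiff ℝ (⊤ : ℕ∞) F
  equivariant : ∀ m q, F (angleShift m q) = angleShift m (F q)
  eq_self : ∀ q, ¬ (q.1 0 ∈ Icc B⁻¹ B ∧ q.1 1 ∈ Icc B⁻¹ B) → F q = q
  mapsTo : ∀ q, (q.1 0 ∈ Icc B⁻¹ B ∧ q.1 1 ∈ Icc B⁻¹ B) →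
    ((F q).1 0 ∈ Icc B⁻¹ B ∧ (F q).1 1 ∈ Icc B⁻¹ B)

open Classical in
/-- The map of phase space induced by a map of action-angle space. -/
def polarLift (B : ℝ) (F : Ph 2 → Ph 2) (p : Ph 2) : Ph 2 :=
  if p ∈ Rtilde B then polarMap (F (polarSection p)) else p

theorem polarLift_of_notMem {B : ℝ} {F : Ph 2 → Ph 2} {p : Ph 2} (h : p ∉ Rtilde B) :
    polarLift B F p = p := if_neg h

theorem polarMap_mem_Rtilde {B : ℝ} {q : Ph 2} (h : q ∈ posAct) :
    polarMap q ∈ Rtilde B ↔ (q.1 0 ∈ Icc B⁻¹ B ∧ q.1 1 ∈ Icc B⁻¹ B) := by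
  simp only [Rtilde, mem_ofPred_eq, actJ_polarMap (h 0).le, actJ_polarMap (h 1).le]

theorem polarLift_polarMap {B : ℝ} {F : Ph 2 → Ph 2} (hF : IsLiftable B F) {q : Ph 2}
    (h : q ∈ posAct) : polarLift B F (polarMap q) = polarMap (F q) := by
  by_cases hq : polarMap q ∈ Rtilde B
  · rw [polarLift, if_pos hq]
    obtain ⟨m, hm⟩ := polarSection_polarMap h
    have : polarSection (polarMap q) = angleShift m q := hm
    rw [this, hF.equivariant, polarMap_angleShift]
  · rw [polarLift_of_notMem hq, hF.eq_self q (by rwa [polarMap_mem_Rtilde h] at hq)]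

theorem IsLiftable.mem_posAct {B : ℝ} (hB : 0 < B) {F : Ph 2 → Ph 2} (hF : IsLiftable B F)
    {q : Ph 2} (h : q ∈ posAct) : F q ∈ posAct := by
  by_cases hq : q.1 0 ∈ Icc B⁻¹ B ∧ q.1 1 ∈ Icc B⁻¹ B
  · have := hF.mapsTo q hq
    have hB' := inv_pos.2 hB
    exact Fin.forall_fin_two.2 ⟨hB'.trans_le this.1.1, hB'.trans_le this.2.1⟩
  · rwa [hF.eq_self q hq]

theorem exists_polarMap_eq {B : ℝ} (hB : 0 < B) {p : Ph 2} (h : p ∈ Rtilde B) :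
    ∃ q ∈ posAct, polarMap q = p := by
  have hB' := inv_pos.2 hB
  exact ⟨polarSection p, Fin.forall_fin_two.2 ⟨hB'.trans_le h.1.1, hB'.trans_le h.2.1⟩,
    polarMap_polarSection p⟩

theorem isClosed_Rtilde (B : ℝ) : IsClosed (Rtilde B) := by
  have h (j : Fin 2) : Continuous (actJ j : Ph 2 → ℝ) := (contDiff_actJ j).continuous
  exact (isClosed_Icc.preimage (h 0)).inter (isClosed_Icc.preimage (h 1))

theorem isCompact_Rtilde (B : ℝ) : IsCompact (Rtilde B) := by
  refine Metric.isCompact_of_isClosed_isBounded (isClosed_Rtilde B) ?_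
  have h0 : ∀ p ∈ Rtilde B, ∀ j, actJ j p ≤ B := fun p hp =>
    Fin.forall_fin_two.2 ⟨hp.1.2, hp.2.2⟩
  refine (Metric.isBounded_closedBall (x := (0 : Ph 2)) (r := 1 + 2 * |B|)).subset fun p hp => ?_
  rw [mem_closedBall_zero_iff, Prod.norm_def, max_le_iff]
  have hB : 0 ≤ 1 + 2 * |B| := by positivity
  constructor <;> refine (pi_norm_le_iff_of_nonneg hB).2 fun j => ?_ <;>
    have h1 := h0 p hp j <;> unfold actJ at h1 <;> rw [Real.norm_eq_abs] <;>
    have h2 := le_abs_self B <;>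
    refine abs_le_of_sq_le_sq ?_ hB <;>
    nlinarith [sq_nonneg (p.1 j), sq_nonneg (p.2 j), abs_nonneg B]

theorem polarLift_eventuallyEq {B : ℝ} {F : Ph 2 → Ph 2} (hF : IsLiftable B F)
    {q : Ph 2} (h : q ∈ posAct) {g : Ph 2 → Ph 2} (hg : g (polarMap q) = q)
    (hgc : ContinuousAt g (polarMap q)) (hgr : ∀ᶠ p in 𝓝 (polarMap q), polarMap (g p) = p) :
    polarLift B F =ᶠ[𝓝 (polarMap q)] fun p => polarMap (F (g p)) := by
  have : ∀ᶠ p in 𝓝 (polarMap q), g p ∈ posAct :=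
    hgc.eventually_mem (by rw [hg]; exact isOpen_posAct.mem_nhds h)
  filter_upwards [this, hgr] with p h1 h2
  conv_lhs => rw [← h2, polarLift_polarMap hF h1]

theorem polarLift_eventuallyEq_id {B : ℝ} {F : Ph 2 → Ph 2} {p : Ph 2} (h : p ∉ Rtilde B) :
    polarLift B F =ᶠ[𝓝 p] id := by
  filter_upwards [(isClosed_Rtilde B).isOpen_compl.mem_nhds h] with x hx
  exact polarLift_of_notMem hx

theorem contDiff_polarLift {B : ℝ} (hB : 0 < B) {F : Ph 2 → Ph 2} (hF : IsLiftable B F) :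
    ContDiff ℝ (⊤ : ℕ∞) (polarLift B F) := by
  refine contDiff_iff_contDiffAt.2 fun p => ?_
  by_cases hp : p ∈ Rtilde B
  · obtain ⟨q, hq, rfl⟩ := exists_polarMap_eq hB hp
    obtain ⟨g, hg, hgs, hgr⟩ := exists_local_polarSection hq
    refine ContDiffAt.congr_of_eventuallyEq ?_
      (polarLift_eventuallyEq hF hq hg hgs.continuousAt hgr)
    have h1 : ContDiffAt ℝ (⊤ : ℕ∞) (fun p => F (g p)) (polarMap q) :=
      hF.smooth.contDiffAt.comp _ hgs
    refine ContDiffAt.comp (polarMap q) (g := polarMap) (f := fun p => F (g p)) ?_ h1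
    rw [hg]
    exact contDiffAt_polarMap (hF.mem_posAct hB hq)
  · exact contDiffAt_id.congr_of_eventuallyEq (polarLift_eventuallyEq_id hp)

theorem leftInverse_polarLift {B : ℝ} (hB : 0 < B) {F G : Ph 2 → Ph 2} (hF : IsLiftable B F)
    (hG : IsLiftable B G) (h : Function.LeftInverse G F) :
    Function.LeftInverse (polarLift B G) (polarLift B F) := by
  intro p
  by_cases hp : p ∈ Rtilde B
  · obtain ⟨q, hq, rfl⟩ := exists_polarMap_eq hB hp
    rw [polarLift_polarMap hF hq, polarLift_polarMap hG (hF.mem_posAct hB hq), h]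
  · rw [polarLift_of_notMem hp, polarLift_of_notMem hp]

theorem isSymplectomorphism_polarLift {B : ℝ} (hB : 0 < B) {F G : Ph 2 → Ph 2}
    (hF : IsLiftable B F) (hG : IsLiftable B G) (h : IsSymplectomorphism F G) :
    IsSymplectomorphism (polarLift B F) (polarLift B G) where
  smooth := contDiff_polarLift hB hF
  smooth_inv := contDiff_polarLift hB hG
  left_inv := leftInverse_polarLift hB hF hG h.left_inv
  right_inv := leftInverse_polarLift hB hG hF h.right_inv
  sympl p v w := by
    by_cases hp : p ∈ Rtilde B
    · obtain ⟨q, hq, rfl⟩ := exists_polarMap_eq hB hp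
      have hd : DifferentiableAt ℝ polarMap q :=
        (contDiffAt_polarMap hq).differentiableAt (by simp)
      have hd' : DifferentiableAt ℝ polarMap (F q) :=
        (contDiffAt_polarMap (hF.mem_posAct hB hq)).differentiableAt (by simp)
      have hL : DifferentiableAt ℝ (polarLift B F) (polarMap q) :=
        (contDiff_polarLift hB hF).differentiable (by simp) _
      have hFd : DifferentiableAt ℝ F q := hF.smooth.differentiable (by simp) _
      have h1 : (fderiv ℝ (polarLift B F) (polarMap q)).comp (fderiv ℝ polarMap q) =
          (fderiv ℝ polarMap (F q)).comp (fderiv ℝ F q) := by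
        rw [← fderiv_comp q hL hd, ← fderiv_comp q hd' hFd]
        refine Filter.EventuallyEq.fderiv_eq ?_
        filter_upwards [isOpen_posAct.mem_nhds hq] with x hx
        exact polarLift_polarMap hF hx
      have h2 (x y : Ph 2) : symplForm
          (fderiv ℝ (polarLift B F) (polarMap q) (fderiv ℝ polarMap q x))
          (fderiv ℝ (polarLift B F) (polarMap q) (fderiv ℝ polarMap q y)) = symplForm x y := by
        have hx := congrArg (fun L => L x) h1
        have hy := congrArg (fun L => L y) h1
        simp only [ContinuousLinearMap.comp_apply] at hx hy
        rw [hx, hy, symplForm_fderiv_polarMap (hF.mem_posAct hB hq), h.sympl]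
      have hs : Function.Surjective (fderiv ℝ polarMap q) := by
        rw [← coe_symplEquiv _ (symplForm_fderiv_polarMap hq)]
        exact (symplEquiv _ (symplForm_fderiv_polarMap hq)).surjective
      obtain ⟨x, rfl⟩ := hs v
      obtain ⟨y, rfl⟩ := hs w
      rw [h2, symplForm_fderiv_polarMap hq]
    · rw [(polarLift_eventuallyEq_id hp).fderiv_eq, fderiv_id]
      rfl

/-- A cut-off rotation in the plane `(X, Y)`, with `q = ((X, v), (Y, ζ))`, corrected in `ζ`
so as to preserve `κ dX ∧ dY + dv ∧ dζ`. The rotation angle is `s τ'(X² + Y²) χ(v)`. -/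
def twist (τ χ : ℝ → ℝ) (κ s : ℝ) (q : Ph 2) : Ph 2 :=
  let K := q.1 0 ^ 2 + q.2 0 ^ 2
  let α := s * deriv τ K * χ (q.1 1)
  (![q.1 0 * Real.cos α - q.2 0 * Real.sin α, q.1 1],
    ![q.1 0 * Real.sin α + q.2 0 * Real.cos α,
      q.2 1 + κ / 2 * (s * τ K * deriv χ (q.1 1))])

section twist

variable {τ χ : ℝ → ℝ} (hτ : ContDiff ℝ (⊤ : ℕ∞) τ) (hχ : ContDiff ℝ (⊤ : ℕ∞) χ) (κ s : ℝ)

theorem ContDiff.deriv_top {f : ℝ → ℝ} (hf : ContDiff ℝ (⊤ : ℕ∞) f) :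
    ContDiff ℝ (⊤ : ℕ∞) (deriv f) :=
  (contDiff_infty_iff_deriv.1 hf).2

include hτ hχ in
theorem contDiff_twist : ContDiff ℝ (⊤ : ℕ∞) (twist τ χ κ s) := by
  have h1 := hτ.deriv_top
  have h2 := hχ.deriv_top
  have hK : ContDiff ℝ (⊤ : ℕ∞) (fun q : Ph 2 => q.1 0 ^ 2 + q.2 0 ^ 2) := by fun_prop
  have hv : ContDiff ℝ (⊤ : ℕ∞) (fun q : Ph 2 => q.1 1) := by fun_prop
  have hα : ContDiff ℝ (⊤ : ℕ∞)
      (fun q : Ph 2 => s * deriv τ (q.1 0 ^ 2 + q.2 0 ^ 2) * χ (q.1 1)) :=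
    (contDiff_const.mul (h1.comp hK)).mul (hχ.comp hv)
  have hβ : ContDiff ℝ (⊤ : ℕ∞)
      (fun q : Ph 2 => s * τ (q.1 0 ^ 2 + q.2 0 ^ 2) * deriv χ (q.1 1)) :=
    (contDiff_const.mul (hτ.comp hK)).mul (h2.comp hv)
  have hc := Real.contDiff_cos.of_le le_top |>.comp hα
  have hs := Real.contDiff_sin.of_le le_top |>.comp hα
  have hx : ContDiff ℝ (⊤ : ℕ∞) (fun q : Ph 2 => q.1 0) := by fun_prop
  have hy : ContDiff ℝ (⊤ : ℕ∞) (fun q : Ph 2 => q.2 0) := by fun_prop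
  have hz : ContDiff ℝ (⊤ : ℕ∞) (fun q : Ph 2 => q.2 1) := by fun_prop
  refine (contDiff_pi.2 (Fin.forall_fin_two.2 ⟨?_, ?_⟩)).prodMk
    (contDiff_pi.2 (Fin.forall_fin_two.2 ⟨?_, ?_⟩))
  · exact (hx.mul hc).sub (hy.mul hs)
  · exact hv
  · exact (hx.mul hs).add (hy.mul hc)
  · exact hz.add (contDiff_const.mul hβ)

theorem twist_sq_add_sq (q : Ph 2) :
    (twist τ χ κ s q).1 0 ^ 2 + (twist τ χ κ s q).2 0 ^ 2 = q.1 0 ^ 2 + q.2 0 ^ 2 := by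
  simp only [twist, Matrix.cons_val_zero]
  have := Real.sin_sq_add_cos_sq (s * deriv τ (q.1 0 ^ 2 + q.2 0 ^ 2) * χ (q.1 1))
  linear_combination (q.1 0 ^ 2 + q.2 0 ^ 2) * this

theorem twist_fst_one (q : Ph 2) : (twist τ χ κ s q).1 1 = q.1 1 := by simp [twist]

theorem twist_neg_twist (q : Ph 2) : twist τ χ κ (-s) (twist τ χ κ s q) = q := by
  have h1 := twist_sq_add_sq (τ := τ) (χ := χ) κ s q
  have h2 := twist_fst_one (τ := τ) (χ := χ) κ s q
  have h3 := Real.sin_sq_add_cos_sq (s * deriv τ (q.1 0 ^ 2 + q.2 0 ^ 2) * χ (q.1 1))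
  refine Prod.ext (funext (Fin.forall_fin_two.2 ⟨?_, ?_⟩)) (funext (Fin.forall_fin_two.2 ⟨?_, ?_⟩))
  · rw [twist, h1, h2]
    simp only [neg_mul, Real.cos_neg, Real.sin_neg, twist, Matrix.cons_val_zero]
    linear_combination q.1 0 * h3
  · rw [twist_fst_one, twist_fst_one]
  · rw [twist, h1, h2]
    simp only [neg_mul, Real.cos_neg, Real.sin_neg, twist, Matrix.cons_val_zero]
    linear_combination q.2 0 * h3
  · rw [twist, h1, h2]
    simp [twist]

theorem twist_eq_self {q : Ph 2} (h1 : deriv τ (q.1 0 ^ 2 + q.2 0 ^ 2) * χ (q.1 1) = 0)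
    (h2 : τ (q.1 0 ^ 2 + q.2 0 ^ 2) * deriv χ (q.1 1) = 0) : twist τ χ κ s q = q := by
  refine Prod.ext (funext (Fin.forall_fin_two.2 ⟨?_, ?_⟩)) (funext (Fin.forall_fin_two.2 ⟨?_, ?_⟩))
    <;> simp [twist, mul_assoc, h1, h2]

include hτ hχ in
theorem weightedForm_fderiv_twist (q v w : Ph 2) :
    κ * ((fderiv ℝ (twist τ χ κ s) q v).1 0 * (fderiv ℝ (twist τ χ κ s) q w).2 0 -
        (fderiv ℝ (twist τ χ κ s) q v).2 0 * (fderiv ℝ (twist τ χ κ s) q w).1 0) +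
      ((fderiv ℝ (twist τ χ κ s) q v).1 1 * (fderiv ℝ (twist τ χ κ s) q w).2 1 -
        (fderiv ℝ (twist τ χ κ s) q v).2 1 * (fderiv ℝ (twist τ χ κ s) q w).1 1) =
    κ * (v.1 0 * w.2 0 - v.2 0 * w.1 0) + (v.1 1 * w.2 1 - v.2 1 * w.1 1) := by
  set K := q.1 0 ^ 2 + q.2 0 ^ 2 with hK
  set α := s * deriv τ K * χ (q.1 1) with hα
  set L := deriv (deriv τ) K
  have key (v : Ph 2) : fderiv ℝ (twist τ χ κ s) q v =
      (let dK := 2 * (q.1 0 * v.1 0 + q.2 0 * v.2 0)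
       let dα := s * (L * dK) * χ (q.1 1) + s * deriv τ K * (deriv χ (q.1 1) * v.1 1)
       (![v.1 0 * Real.cos α - v.2 0 * Real.sin α -
            dα * (q.1 0 * Real.sin α + q.2 0 * Real.cos α), v.1 1],
        ![v.1 0 * Real.sin α + v.2 0 * Real.cos α +
            dα * (q.1 0 * Real.cos α - q.2 0 * Real.sin α),
          v.2 1 + κ / 2 * (s * (deriv τ K * dK) * deriv χ (q.1 1) +
            s * τ K * (deriv (deriv χ) (q.1 1) * v.1 1))])) := by
    refine fderiv_apply_eq_of_hasDerivAt ((contDiff_twist hτ hχ κ s).differentiable (by simp) q) ?_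
    have hl (a b : ℝ) : HasDerivAt (fun t : ℝ => a + t * b) b 0 := by
      simpa using ((hasDerivAt_id (0 : ℝ)).mul_const b).const_add a
    have hx := hl (q.1 0) (v.1 0)
    have hy := hl (q.2 0) (v.2 0)
    have hv := hl (q.1 1) (v.1 1)
    have hz := hl (q.2 1) (v.2 1)
    have hKd : HasDerivAt (fun t : ℝ => (q.1 0 + t * v.1 0) ^ 2 + (q.2 0 + t * v.2 0) ^ 2)
        (2 * (q.1 0 * v.1 0 + q.2 0 * v.2 0)) 0 := by
      refine ((hx.pow 2).add (hy.pow 2)).congr_deriv ?_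
      simp; ring
    have hc {f : ℝ → ℝ} (hf : ContDiff ℝ (⊤ : ℕ∞) f) {g : ℝ → ℝ} {g' x : ℝ}
        (hg : HasDerivAt g g' 0) (hx : g 0 = x) :
        HasDerivAt (fun t => f (g t)) (deriv f x * g') 0 := by
      subst hx
      exact ((hf.differentiable (by simp) _).hasDerivAt).comp 0 hg
    have h0 : (q.1 0 + 0 * v.1 0) ^ 2 + (q.2 0 + 0 * v.2 0) ^ 2 = K := by simp [hK]
    have h1 : q.1 1 + 0 * v.1 1 = q.1 1 := by simp
    have hαd := ((hc hτ.deriv_top hKd h0).const_mul s).mul (hc hχ hv h1)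
    have hβd := (((hc hτ hKd h0).const_mul s).mul (hc hχ.deriv_top hv h1)).const_mul (κ / 2)
    have e1 : (q.1 0 + 0 * v.1 0) = q.1 0 := by simp
    have e2 : (q.2 0 + 0 * v.2 0) = q.2 0 := by simp
    refine HasDerivAt.prodMk (hasDerivAt_pi.2 (Fin.forall_fin_two.2 ⟨?_, ?_⟩))
      (hasDerivAt_pi.2 (Fin.forall_fin_two.2 ⟨?_, ?_⟩))
    · refine ((hx.mul hαd.cos).sub (hy.mul hαd.sin)).congr_deriv ?_
      simp only [e1, e2, h1, ← hK, ← hα, Pi.mul_apply, Matrix.cons_val_zero]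
      ring
    · exact hv
    · refine ((hx.mul hαd.sin).add (hy.mul hαd.cos)).congr_deriv ?_
      simp only [e1, e2, h1, ← hK, ← hα, Pi.mul_apply, Matrix.cons_val_zero]
      ring
    · refine (hz.add hβd).congr_deriv ?_
      simp only [e1, e2, h1, ← hK, Matrix.cons_val_one, Matrix.cons_val_zero]
  have h3 := Real.sin_sq_add_cos_sq α
  simp only [key, Matrix.cons_val_zero, Matrix.cons_val_one]
  linear_combination κ * ((v.1 0 * w.2 0 - v.2 0 * w.1 0) +
    (q.1 0 * v.1 0 + q.2 0 * v.2 0) *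
      (s * (L * (2 * (q.1 0 * w.1 0 + q.2 0 * w.2 0))) * χ (q.1 1) +
        s * deriv τ K * (deriv χ (q.1 1) * w.1 1)) -
    (q.1 0 * w.1 0 + q.2 0 * w.2 0) *
      (s * (L * (2 * (q.1 0 * v.1 0 + q.2 0 * v.2 0))) * χ (q.1 1) +
        s * deriv τ K * (deriv χ (q.1 1) * v.1 1))) * h3

end twist

/-- The profiles and the positions of the `N` cells of a piecewise twist. -/
structure CellData (B : ℝ) where
  N : ℕ
  N_pos : 0 < N
  c₁ : ℤ → ℝ
  c₂ : ℤ → ℝ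
  a : ℤ → ℝ
  a_ne : ∀ n, a n ≠ 0
  c₁_add : ∀ n m, c₁ (n + N * m) = c₁ n
  c₂_add : ∀ n m, c₂ (n + N * m) = c₂ n
  a_add : ∀ n m, a (n + N * m) = a n
  τ : ℝ → ℝ
  χ : ℝ → ℝ
  contDiff_τ : ContDiff ℝ (⊤ : ℕ∞) τ
  contDiff_χ : ContDiff ℝ (⊤ : ℕ∞) χ
  Kmax : ℝ
  vmax : ℝ
  Kmax_le : Kmax ≤ 5 / 2
  τ_eq : ∀ K, Kmax < K → τ K = 0
  χ_eq : ∀ v, vmax < |v| → χ v = 0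

namespace CellData

variable {B : ℝ} (D : CellData B) (k₁ k₂ : ℤ)

/-- The cells of `D` sheared with slope `k₂ / k₁` lie over the square `[B⁻¹, B]²`. -/
def InBox : Prop := ∀ n X v, X ^ 2 ≤ D.Kmax → |v| ≤ D.vmax →
    D.c₁ n + D.a n * X ∈ Icc B⁻¹ B ∧ D.c₂ n + v + (k₂ / k₁ : ℝ) * (D.a n * X) ∈ Icc B⁻¹ B

/-- The resonant angle, normalised so that the cells are centred at the integers. -/
def cellAngle (q : Ph 2) : ℝ := (k₁ * q.2 0 + k₂ * q.2 1) * (D.N / (2 * Real.pi))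

/-- Coordinates adapted to the `n`-th cell. -/
def frame (n : ℤ) (q : Ph 2) : Ph 2 :=
  (![(q.1 0 - D.c₁ n) / D.a n, (q.1 1 - D.c₂ n) - (k₂ / k₁ : ℝ) * (q.1 0 - D.c₁ n)],
    ![4 * (D.cellAngle k₁ k₂ q - n), q.2 1])

/-- The inverse of `frame`. -/
def unframe (n : ℤ) (z : Ph 2) : Ph 2 :=
  (![D.c₁ n + D.a n * z.1 0, D.c₂ n + z.1 1 + (k₂ / k₁ : ℝ) * (D.a n * z.1 0)],
    ![((z.2 0 / 4 + n) * (2 * Real.pi / D.N) - k₂ * z.2 1) / k₁, z.2 1])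

/-- The twist in the `n`-th cell. -/
def window (s : ℝ) (n : ℤ) (q : Ph 2) : Ph 2 :=
  D.unframe k₁ k₂ n (twist D.τ D.χ (D.a n * (Real.pi / (2 * D.N)) / k₁) s (D.frame k₁ k₂ n q))

/-- The piecewise twist. -/
def cellMap (s : ℝ) (q : Ph 2) : Ph 2 := D.window k₁ k₂ s (round (D.cellAngle k₁ k₂ q)) q

variable {k₁ k₂}

theorem N_ne : (D.N : ℝ) ≠ 0 := by have := D.N_pos; positivity

theorem unframe_frame (h : k₁ ≠ 0) (n : ℤ) (q : Ph 2) :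
    D.unframe k₁ k₂ n (D.frame k₁ k₂ n q) = q := by
  have h' : (k₁ : ℝ) ≠ 0 := by exact_mod_cast h
  have ha := D.a_ne n
  have hN := D.N_ne
  have hπ := Real.pi_ne_zero
  refine Prod.ext (funext (Fin.forall_fin_two.2 ⟨?_, ?_⟩)) (funext (Fin.forall_fin_two.2 ⟨?_, ?_⟩))
    <;> simp [unframe, frame, cellAngle] <;> field_simp <;> ring

theorem frame_unframe (h : k₁ ≠ 0) (n : ℤ) (q : Ph 2) :
    D.frame k₁ k₂ n (D.unframe k₁ k₂ n q) = q := by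
  have h' : (k₁ : ℝ) ≠ 0 := by exact_mod_cast h
  have ha := D.a_ne n
  have hN := D.N_ne
  have hπ := Real.pi_ne_zero
  refine Prod.ext (funext (Fin.forall_fin_two.2 ⟨?_, ?_⟩)) (funext (Fin.forall_fin_two.2 ⟨?_, ?_⟩))
    <;> simp [unframe, frame, cellAngle] <;> field_simp <;> ring

theorem frame_window (h : k₁ ≠ 0) (s : ℝ) (n : ℤ) (q : Ph 2) :
    D.frame k₁ k₂ n (D.window k₁ k₂ s n q) =
      twist D.τ D.χ (D.a n * (Real.pi / (2 * D.N)) / k₁) s (D.frame k₁ k₂ n q) :=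
  D.frame_unframe h _ _

theorem window_neg_window (h : k₁ ≠ 0) (s : ℝ) (n : ℤ) (q : Ph 2) :
    D.window k₁ k₂ (-s) n (D.window k₁ k₂ s n q) = q := by
  rw [window, frame_window _ h, twist_neg_twist, unframe_frame _ h]

theorem frame_snd_zero (n : ℤ) (q : Ph 2) :
    (D.frame k₁ k₂ n q).2 0 = 4 * (D.cellAngle k₁ k₂ q - n) := rfl

theorem twist_eq_self_of (κ s : ℝ) {q : Ph 2}
    (h : D.Kmax < q.1 0 ^ 2 + q.2 0 ^ 2 ∨ D.vmax < |q.1 1|) : twist D.τ D.χ κ s q = q := by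
  rcases h with h | h
  · have h0 : D.τ =ᶠ[𝓝 (q.1 0 ^ 2 + q.2 0 ^ 2)] fun _ => 0 := by
      filter_upwards [Ioi_mem_nhds h] with x hx using D.τ_eq x hx
    refine twist_eq_self κ s ?_ ?_
    · rw [h0.deriv_eq]; simp
    · rw [D.τ_eq _ h]; simp
  · have h0 : D.χ =ᶠ[𝓝 (q.1 1)] fun _ => 0 := by
      filter_upwards [(isOpen_lt continuous_const continuous_abs).mem_nhds h] with x hx
        using D.χ_eq x hx
    refine twist_eq_self κ s ?_ ?_
    · rw [D.χ_eq _ h]; simp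
    · rw [h0.deriv_eq]; simp

theorem window_eq_self (h : k₁ ≠ 0) (s : ℝ) {n : ℤ} {q : Ph 2}
    (hq : D.Kmax < (D.frame k₁ k₂ n q).1 0 ^ 2 + (D.frame k₁ k₂ n q).2 0 ^ 2 ∨
      D.vmax < |(D.frame k₁ k₂ n q).1 1|) : D.window k₁ k₂ s n q = q := by
  rw [window, D.twist_eq_self_of _ _ hq, D.unframe_frame h]

theorem window_eq_self_of_far (h : k₁ ≠ 0) (s : ℝ) {n : ℤ} {q : Ph 2}
    (hq : 2 / 5 ≤ |D.cellAngle k₁ k₂ q - n|) : D.window k₁ k₂ s n q = q := by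
  refine D.window_eq_self h s (.inl (D.Kmax_le.trans_lt ?_))
  rw [frame_snd_zero]
  nlinarith [sq_nonneg ((D.frame k₁ k₂ n q).1 0), sq_abs (D.cellAngle k₁ k₂ q - n)]

theorem cellMap_eq_window (h : k₁ ≠ 0) (s : ℝ) {n : ℤ} {q : Ph 2}
    (hq : |D.cellAngle k₁ k₂ q - n| ≤ 3 / 5) : D.cellMap k₁ k₂ s q = D.window k₁ k₂ s n q := by
  set u := D.cellAngle k₁ k₂ q with hu
  by_cases hn : round u = n
  · rw [cellMap, ← hu, hn]
  · have h1 : (1 : ℝ) ≤ |(round u : ℝ) - n| := by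
      have : 1 ≤ |round u - n| := Int.one_le_abs (sub_ne_zero.2 hn)
      exact_mod_cast this
    have h2 := abs_sub_round u
    have h3 : |(round u : ℝ) - n| ≤ |u - round u| + |u - n| := by
      have := abs_sub_le (round u : ℝ) u n
      rwa [abs_sub_comm _ u] at this
    rw [cellMap, ← hu, D.window_eq_self_of_far h, D.window_eq_self_of_far h]
    · rw [← hu]; linarith
    · rw [← hu]; linarith

theorem cellMap_neg_cellMap (h : k₁ ≠ 0) (s : ℝ) (q : Ph 2) :
    D.cellMap k₁ k₂ (-s) (D.cellMap k₁ k₂ s q) = q := by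
  set n := round (D.cellAngle k₁ k₂ q) with hn
  have h0 : D.cellMap k₁ k₂ s q = D.window k₁ k₂ s n q := rfl
  have h1 : |D.cellAngle k₁ k₂ q - n| ≤ 1 / 2 := abs_sub_round _
  rw [h0, D.cellMap_eq_window h (-s) (n := n), D.window_neg_window h]
  by_cases hK : D.Kmax < (D.frame k₁ k₂ n q).1 0 ^ 2 + (D.frame k₁ k₂ n q).2 0 ^ 2
  · rw [D.window_eq_self h s (.inl hK)]; linarith
  · have h2 := twist_sq_add_sq (τ := D.τ) (χ := D.χ) (D.a n * (Real.pi / (2 * D.N)) / k₁) s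
      (D.frame k₁ k₂ n q)
    rw [← D.frame_window h] at h2
    have h3 := D.frame_snd_zero (k₁ := k₁) (k₂ := k₂) n (D.window k₁ k₂ s n q)
    have h4 := D.Kmax_le
    rw [h3] at h2
    refine abs_le_of_sq_le_sq ?_ (by norm_num)
    nlinarith [sq_nonneg ((D.frame k₁ k₂ n (D.window k₁ k₂ s n q)).1 0)]

theorem contDiff_frame (n : ℤ) : ContDiff ℝ (⊤ : ℕ∞) (D.frame k₁ k₂ n) := by
  refine (contDiff_pi.2 (Fin.forall_fin_two.2 ⟨?_, ?_⟩)).prodMk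
    (contDiff_pi.2 (Fin.forall_fin_two.2 ⟨?_, ?_⟩))
  · exact ContDiff.div_const (by fun_prop) _
  · show ContDiff ℝ (⊤ : ℕ∞) fun q : Ph 2 =>
      (q.1 1 - D.c₂ n) - (k₂ / k₁ : ℝ) * (q.1 0 - D.c₁ n)
    fun_prop
  · show ContDiff ℝ (⊤ : ℕ∞) fun q : Ph 2 =>
      4 * ((k₁ * q.2 0 + k₂ * q.2 1) * (D.N / (2 * Real.pi)) - n)
    fun_prop
  · show ContDiff ℝ (⊤ : ℕ∞) fun q : Ph 2 => q.2 1
    fun_prop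

theorem contDiff_unframe (n : ℤ) : ContDiff ℝ (⊤ : ℕ∞) (D.unframe k₁ k₂ n) := by
  refine (contDiff_pi.2 (Fin.forall_fin_two.2 ⟨?_, ?_⟩)).prodMk
    (contDiff_pi.2 (Fin.forall_fin_two.2 ⟨?_, ?_⟩))
  · show ContDiff ℝ (⊤ : ℕ∞) fun z : Ph 2 => D.c₁ n + D.a n * z.1 0
    fun_prop
  · show ContDiff ℝ (⊤ : ℕ∞) fun z : Ph 2 => D.c₂ n + z.1 1 + (k₂ / k₁ : ℝ) * (D.a n * z.1 0)
    fun_prop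
  · exact ContDiff.div_const (by fun_prop) _
  · show ContDiff ℝ (⊤ : ℕ∞) fun z : Ph 2 => z.2 1
    fun_prop

theorem contDiff_window (s : ℝ) (n : ℤ) : ContDiff ℝ (⊤ : ℕ∞) (D.window k₁ k₂ s n) :=
  (D.contDiff_unframe n).comp
    ((contDiff_twist D.contDiff_τ D.contDiff_χ _ s).comp (D.contDiff_frame n))

theorem continuous_cellAngle : Continuous (D.cellAngle k₁ k₂) := by
  unfold cellAngle
  fun_prop

theorem cellMap_eventuallyEq (h : k₁ ≠ 0) (s : ℝ) (q : Ph 2) :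
    D.cellMap k₁ k₂ s =ᶠ[𝓝 q] D.window k₁ k₂ s (round (D.cellAngle k₁ k₂ q)) := by
  have h1 := abs_sub_round (D.cellAngle k₁ k₂ q)
  have h2 : Continuous fun x => |D.cellAngle k₁ k₂ x - round (D.cellAngle k₁ k₂ q)| :=
    (D.continuous_cellAngle.sub continuous_const).abs
  have h3 : ∀ᶠ x in 𝓝 q, |D.cellAngle k₁ k₂ x - round (D.cellAngle k₁ k₂ q)| < 3 / 5 :=
    h2.continuousAt.eventually_lt_const (by linarith)
  filter_upwards [h3] with x hx
  exact D.cellMap_eq_window h s hx.le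

theorem contDiff_cellMap (h : k₁ ≠ 0) (s : ℝ) : ContDiff ℝ (⊤ : ℕ∞) (D.cellMap k₁ k₂ s) :=
  contDiff_iff_contDiffAt.2 fun q =>
    (D.contDiff_window s _).contDiffAt.congr_of_eventuallyEq (D.cellMap_eventuallyEq h s q)

theorem symplForm_fderiv_window (h : k₁ ≠ 0) (s : ℝ) (n : ℤ) (q v w : Ph 2) :
    symplForm (fderiv ℝ (D.window k₁ k₂ s n) q v) (fderiv ℝ (D.window k₁ k₂ s n) q w) =
      symplForm v w := by
  have h' : (k₁ : ℝ) ≠ 0 := by exact_mod_cast h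
  have ha := D.a_ne n
  have hN := D.N_ne
  have hπ := Real.pi_ne_zero
  set κ := D.a n * (Real.pi / (2 * D.N)) / k₁ with hκ
  have hl (a b : ℝ) : HasDerivAt (fun t : ℝ => a + t * b) b 0 := by
    simpa using ((hasDerivAt_id (0 : ℝ)).mul_const b).const_add a
  have hF (q v : Ph 2) : fderiv ℝ (D.frame k₁ k₂ n) q v =
      (![v.1 0 / D.a n, v.1 1 - (k₂ / k₁ : ℝ) * v.1 0],
        ![4 * ((k₁ * v.2 0 + k₂ * v.2 1) * (D.N / (2 * Real.pi))), v.2 1]) := by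
    refine fderiv_apply_eq_of_hasDerivAt ((D.contDiff_frame n).differentiable (by simp) q) ?_
    refine HasDerivAt.prodMk (hasDerivAt_pi.2 (Fin.forall_fin_two.2 ⟨?_, ?_⟩))
      (hasDerivAt_pi.2 (Fin.forall_fin_two.2 ⟨?_, ?_⟩))
    · exact ((hl (q.1 0) (v.1 0)).sub_const _).div_const _
    · exact ((hl (q.1 1) (v.1 1)).sub_const _).sub (((hl (q.1 0) (v.1 0)).sub_const _).const_mul _)
    · exact (((((hl (q.2 0) (v.2 0)).const_mul (k₁ : ℝ)).add
        ((hl (q.2 1) (v.2 1)).const_mul (k₂ : ℝ))).mul_const _).sub_const _).const_mul 4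
    · exact hl (q.2 1) (v.2 1)
  have hU (q v : Ph 2) : fderiv ℝ (D.unframe k₁ k₂ n) q v =
      (![D.a n * v.1 0, v.1 1 + (k₂ / k₁ : ℝ) * (D.a n * v.1 0)],
        ![((v.2 0 / 4) * (2 * Real.pi / D.N) - k₂ * v.2 1) / k₁, v.2 1]) := by
    refine fderiv_apply_eq_of_hasDerivAt ((D.contDiff_unframe n).differentiable (by simp) q) ?_
    refine HasDerivAt.prodMk (hasDerivAt_pi.2 (Fin.forall_fin_two.2 ⟨?_, ?_⟩))
      (hasDerivAt_pi.2 (Fin.forall_fin_two.2 ⟨?_, ?_⟩))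
    · exact ((hl (q.1 0) (v.1 0)).const_mul _).const_add _
    · exact ((hl (q.1 1) (v.1 1)).const_add _).add
        (((hl (q.1 0) (v.1 0)).const_mul _).const_mul _)
    · exact (((((hl (q.2 0) (v.2 0)).div_const 4).add_const _).mul_const _).sub
        ((hl (q.2 1) (v.2 1)).const_mul (k₂ : ℝ))).div_const _
    · exact hl (q.2 1) (v.2 1)
  have hd (v : Ph 2) : fderiv ℝ (D.window k₁ k₂ s n) q v =
      fderiv ℝ (D.unframe k₁ k₂ n) (twist D.τ D.χ κ s (D.frame k₁ k₂ n q))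
        (fderiv ℝ (twist D.τ D.χ κ s) (D.frame k₁ k₂ n q) (fderiv ℝ (D.frame k₁ k₂ n) q v)) := by
    have h1 : DifferentiableAt ℝ (D.frame k₁ k₂ n) q :=
      (D.contDiff_frame n).differentiable (by simp) q
    have h2 : DifferentiableAt ℝ (twist D.τ D.χ κ s) (D.frame k₁ k₂ n q) :=
      (contDiff_twist D.contDiff_τ D.contDiff_χ κ s).differentiable (by simp) _
    have h3 : DifferentiableAt ℝ (D.unframe k₁ k₂ n) (twist D.τ D.χ κ s (D.frame k₁ k₂ n q)) :=
      (D.contDiff_unframe n).differentiable (by simp) _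
    have := (h3.hasFDerivAt.comp q (h2.hasFDerivAt.comp q h1.hasFDerivAt)).fderiv
    have h4 : D.window k₁ k₂ s n =
      (D.unframe k₁ k₂ n) ∘ (twist D.τ D.χ κ s) ∘ (D.frame k₁ k₂ n) := rfl
    rw [h4, this]
    rfl
  have key := weightedForm_fderiv_twist D.contDiff_τ D.contDiff_χ κ s (D.frame k₁ k₂ n q)
    (fderiv ℝ (D.frame k₁ k₂ n) q v) (fderiv ℝ (D.frame k₁ k₂ n) q w)
  rw [hd, hd]
  set x := fderiv ℝ (twist D.τ D.χ κ s) (D.frame k₁ k₂ n q) (fderiv ℝ (D.frame k₁ k₂ n) q v)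
  set y := fderiv ℝ (twist D.τ D.χ κ s) (D.frame k₁ k₂ n q) (fderiv ℝ (D.frame k₁ k₂ n) q w)
  rw [hU, hU]
  rw [hF, hF] at key
  simp only [symplForm_two, Matrix.cons_val_zero, Matrix.cons_val_one] at key ⊢
  have e1 : D.a n * x.1 0 * (((y.2 0 / 4) * (2 * Real.pi / D.N) - k₂ * y.2 1) / k₁) -
      ((x.2 0 / 4) * (2 * Real.pi / D.N) - k₂ * x.2 1) / k₁ * (D.a n * y.1 0) +
      ((x.1 1 + (k₂ / k₁ : ℝ) * (D.a n * x.1 0)) * y.2 1 -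
        x.2 1 * (y.1 1 + (k₂ / k₁ : ℝ) * (D.a n * y.1 0))) =
      κ * (x.1 0 * y.2 0 - x.2 0 * y.1 0) + (x.1 1 * y.2 1 - x.2 1 * y.1 1) := by
    rw [hκ]; field_simp; ring
  rw [e1, key, hκ]
  field_simp
  ring

theorem isSymplectomorphism_cellMap (h : k₁ ≠ 0) (s : ℝ) :
    IsSymplectomorphism (D.cellMap k₁ k₂ s) (D.cellMap k₁ k₂ (-s)) where
  smooth := D.contDiff_cellMap h s
  smooth_inv := D.contDiff_cellMap h (-s)
  left_inv := D.cellMap_neg_cellMap h s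
  right_inv q := by
    have := D.cellMap_neg_cellMap (k₂ := k₂) h (-s) q
    rwa [neg_neg] at this
  sympl q v w := by
    rw [(D.cellMap_eventuallyEq h s q).fderiv_eq, D.symplForm_fderiv_window h]

theorem cellAngle_angleShift (m : Fin 2 → ℤ) (q : Ph 2) :
    D.cellAngle k₁ k₂ (angleShift m q) =
      D.cellAngle k₁ k₂ q + (D.N * (k₁ * m 0 + k₂ * m 1) : ℤ) := by
  have hπ := Real.pi_ne_zero
  simp only [cellAngle, angleShift]
  push_cast
  field_simp
  ring

theorem cellMap_angleShift (h : k₁ ≠ 0) (s : ℝ) (m : Fin 2 → ℤ) (q : Ph 2) :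
    D.cellMap k₁ k₂ s (angleShift m q) = angleShift m (D.cellMap k₁ k₂ s q) := by
  have h' : (k₁ : ℝ) ≠ 0 := by exact_mod_cast h
  have hN := D.N_ne
  set n := round (D.cellAngle k₁ k₂ q) with hn
  have hr : round (D.cellAngle k₁ k₂ (angleShift m q)) = n + D.N * (k₁ * m 0 + k₂ * m 1) := by
    rw [cellAngle_angleShift, round_add_intCast]
  have hf : D.frame k₁ k₂ (n + D.N * (k₁ * m 0 + k₂ * m 1)) (angleShift m q) =
      ((D.frame k₁ k₂ n q).1, ![(D.frame k₁ k₂ n q).2 0,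
        (D.frame k₁ k₂ n q).2 1 + m 1 * (2 * Real.pi)]) := by
    simp only [frame, D.c₁_add, D.c₂_add, D.a_add, cellAngle_angleShift]
    simp only [angleShift, Matrix.cons_val_zero, Matrix.cons_val_one]
    congr 2
    push_cast
    ring
  rw [cellMap, hr, cellMap, ← hn, window, window, hf]
  refine Prod.ext (funext (Fin.forall_fin_two.2 ⟨?_, ?_⟩)) (funext (Fin.forall_fin_two.2 ⟨?_, ?_⟩))
    <;> simp only [unframe, twist, angleShift, D.c₁_add, D.c₂_add, D.a_add, Matrix.cons_val_zero,
      Matrix.cons_val_one]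
  · push_cast
    field_simp
    ring
  · ring

theorem isLiftable_cellMap (h : k₁ ≠ 0) (hB : D.InBox k₁ k₂) (s : ℝ) :
    IsLiftable B (D.cellMap k₁ k₂ s) where
  smooth := D.contDiff_cellMap h s
  equivariant := D.cellMap_angleShift h s
  eq_self q hq := by
    by_contra hne
    refine hq ?_
    set n := round (D.cellAngle k₁ k₂ q) with hn
    have h0 := mt (D.window_eq_self h s (n := n)) hne
    push Not at h0
    have h1 := hB n _ _ ((le_add_of_nonneg_right (sq_nonneg _)).trans h0.1) h0.2
    have h2 := D.unframe_frame (k₂ := k₂) h n q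
    rw [← h2]
    exact h1
  mapsTo q hq := by
    set n := round (D.cellAngle k₁ k₂ q) with hn
    by_cases h0 : D.Kmax < (D.frame k₁ k₂ n q).1 0 ^ 2 + (D.frame k₁ k₂ n q).2 0 ^ 2 ∨
      D.vmax < |(D.frame k₁ k₂ n q).1 1|
    · rw [cellMap, ← hn, D.window_eq_self h s h0]; exact hq
    · push Not at h0
      rw [← twist_sq_add_sq (τ := D.τ) (χ := D.χ) (D.a n * (Real.pi / (2 * D.N)) / k₁) s,
        ← twist_fst_one (τ := D.τ) (χ := D.χ) (D.a n * (Real.pi / (2 * D.N)) / k₁) s] at h0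
      exact hB n _ _ ((le_add_of_nonneg_right (sq_nonneg _)).trans h0.1) h0.2

end CellData

theorem ContDiffAt.exists_open_norm_iteratedFDeriv_le {E F : Type*} [NormedAddCommGroup E]
    [NormedSpace ℝ E] [NormedAddCommGroup F] [NormedSpace ℝ F] {h : E → F} {z : E} {n : ℕ}
    (hh : ContDiffAt ℝ n h z) : ∃ W : Set E, IsOpen W ∧ z ∈ W ∧ ContDiffOn ℝ n h W ∧
      ∃ M : ℝ, 1 ≤ M ∧ ∀ x ∈ W, ∀ i ≤ n, ‖iteratedFDeriv ℝ i h x‖ ≤ M := by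
  obtain ⟨W₀, hW₀, ho, hz⟩ := _root_.eventually_nhds_iff.1 (hh.eventually (by simp))
  have hc : ContDiffOn ℝ n h W₀ := fun x hx => (hW₀ x hx).contDiffWithinAt
  have h1 (i : ℕ) (hi : i ≤ n) :
      ∀ᶠ x in 𝓝 z, ‖iteratedFDeriv ℝ i h x‖ < ‖iteratedFDeriv ℝ i h z‖ + 1 := by
    have h2 : ContinuousOn (iteratedFDeriv ℝ i h) W₀ :=
      (hc.continuousOn_iteratedFDerivWithin (by exact_mod_cast hi) ho.uniqueDiffOn).congr
        fun x hx => (iteratedFDerivWithin_of_isOpen i ho hx).symm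
    have h3 := (h2.continuousAt (ho.mem_nhds hz)).norm
    exact h3.eventually_lt_const (lt_add_one _)
  have h2 : ∀ᶠ x in 𝓝 z, ∀ i ∈ Finset.range (n + 1),
      ‖iteratedFDeriv ℝ i h x‖ < ‖iteratedFDeriv ℝ i h z‖ + 1 :=
    (Finset.eventually_all _).2 fun i hi => h1 i (by simpa [Nat.lt_succ_iff] using hi)
  obtain ⟨W₁, hW₁, ho₁, hz₁⟩ := _root_.eventually_nhds_iff.1 h2
  refine ⟨W₀ ∩ W₁, ho.inter ho₁, ⟨hz, hz₁⟩, hc.mono inter_subset_left,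
    ∑ i ∈ Finset.range (n + 1), ‖iteratedFDeriv ℝ i h z‖ + 1, ?_, fun x hx i hi => ?_⟩
  · linarith [Finset.sum_nonneg (s := Finset.range (n + 1))
      (f := fun i => ‖iteratedFDeriv ℝ i h z‖) (fun i _ => norm_nonneg _)]
  · have hi' : i ∈ Finset.range (n + 1) := by simpa [Nat.lt_succ_iff] using hi
    have := Finset.single_le_sum (f := fun i => ‖iteratedFDeriv ℝ i h z‖)
      (fun i _ => norm_nonneg _) hi'
    exact (hW₁ x hx.2 i hi').le.trans (by linarith)

theorem norm_iteratedFDeriv_comp_affine_le {E F F' G : Type*} [NormedAddCommGroup E]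
    [NormedSpace ℝ E] [NormedAddCommGroup F] [NormedSpace ℝ F] [NormedAddCommGroup F']
    [NormedSpace ℝ F'] [NormedAddCommGroup G] [NormedSpace ℝ G] {g : F' → G} {h : E → F}
    {W : Set E} (ho : IsOpen W) {n : ℕ} (hg : ContDiff ℝ n g) (hh : ContDiffOn ℝ n h W)
    (L : F →L[ℝ] F') (c : F') {x : E} (hx : x ∈ W) {C M Λ : ℝ} (hM : 1 ≤ M) (hΛ : 1 ≤ Λ)
    (hL : ‖L‖ ≤ Λ) (hC : ∀ i ≤ n, ∀ y, ‖iteratedFDeriv ℝ i g y‖ ≤ C)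
    (hD : ∀ i ≤ n, ‖iteratedFDeriv ℝ i h x‖ ≤ M) :
    ‖iteratedFDeriv ℝ n (fun x => g (L (h x) + c)) x‖ ≤ n.factorial * C * (Λ * M) ^ n := by
  have hg' : ContDiff ℝ n (fun y => g (y + c)) := hg.comp (contDiff_id.add contDiff_const)
  have key := norm_iteratedFDerivWithin_comp_le (g := fun y => g (y + c)) (f := fun x => L (h x))
    (t := univ) hg'.contDiffOn (L.contDiff.comp_contDiffOn hh) le_rfl uniqueDiffOn_univ
    ho.uniqueDiffOn (mapsTo_univ _ _) hx (C := C) (D := Λ * M) ?_ ?_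
  · rwa [iteratedFDerivWithin_of_isOpen n ho hx] at key
  · intro i hi
    rw [iteratedFDerivWithin_univ, iteratedFDeriv_comp_add_right]
    exact hC i hi _
  · intro i h1 hi
    have h2 := L.norm_iteratedFDerivWithin_comp_left (hh.contDiffWithinAt hx) ho.uniqueDiffOn hx
      (n := i) (by exact_mod_cast hi)
    rw [iteratedFDerivWithin_of_isOpen i ho hx] at h2
    have h3 : ‖L‖ * ‖iteratedFDerivWithin ℝ i h W x‖ ≤ Λ * M := by
      rw [iteratedFDerivWithin_of_isOpen i ho hx]
      exact mul_le_mul hL (hD i hi) (norm_nonneg _) (by linarith)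
    have h4 : 1 ≤ Λ * M := one_le_mul_of_one_le_of_one_le hΛ hM
    rw [iteratedFDerivWithin_of_isOpen i ho hx]
    exact h2.trans (h3.trans (le_self_pow₀ h4 (by omega)))

theorem exists_norm_iteratedFDeriv_le_of_hasCompactSupport {E F : Type*} [NormedAddCommGroup E]
    [NormedSpace ℝ E] [NormedAddCommGroup F] [NormedSpace ℝ F] {g : E → F} (n : ℕ)
    (hg : ContDiff ℝ n g) (hs : HasCompactSupport g) :
    ∃ C : ℝ, 0 ≤ C ∧ ∀ i ≤ n, ∀ y, ‖iteratedFDeriv ℝ i g y‖ ≤ C := by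
  have h1 (i : ℕ) : ∃ C : ℝ, i ≤ n → ∀ y, ‖iteratedFDeriv ℝ i g y‖ ≤ C := by
    by_cases hi : i ≤ n
    · obtain ⟨C, hC⟩ := (hg.continuous_iteratedFDeriv (m := i)
        (by exact_mod_cast hi)).bounded_above_of_compact_support (hs.iteratedFDeriv i)
      exact ⟨C, fun _ => hC⟩
    · exact ⟨0, fun h => absurd h hi⟩
  choose C hC using h1
  refine ⟨∑ i ∈ Finset.range (n + 1), |C i|, Finset.sum_nonneg fun i _ => abs_nonneg _,
    fun i hi y => ?_⟩
  exact ((hC i hi y).trans (le_abs_self _)).trans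
    (Finset.single_le_sum (f := fun i => |C i|) (fun i _ => abs_nonneg _)
      (by simpa [Nat.lt_succ_iff] using hi))

namespace CellData

variable {B : ℝ} (D : CellData B)

/-- The increment of the first frame coordinate under a twist. -/
def twistIncr (s : ℝ) (p : ℝ × ℝ × ℝ) : ℝ :=
  let α := s * deriv D.τ (p.1 ^ 2 + p.2.2 ^ 2) * D.χ p.2.1
  p.1 * Real.cos α - p.2.2 * Real.sin α - p.1

theorem contDiff_twistIncr (s : ℝ) : ContDiff ℝ (⊤ : ℕ∞) (D.twistIncr s) := by
  have hK : ContDiff ℝ (⊤ : ℕ∞) (fun p : ℝ × ℝ × ℝ => p.1 ^ 2 + p.2.2 ^ 2) := by fun_prop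
  have hα : ContDiff ℝ (⊤ : ℕ∞)
      (fun p : ℝ × ℝ × ℝ => s * deriv D.τ (p.1 ^ 2 + p.2.2 ^ 2) * D.χ p.2.1) :=
    (contDiff_const.mul (D.contDiff_τ.deriv_top.comp hK)).mul (D.contDiff_χ.comp (by fun_prop))
  have hc := Real.contDiff_cos.of_le le_top |>.comp hα
  have hs := Real.contDiff_sin.of_le le_top |>.comp hα
  exact ((contDiff_fst.mul hc).sub ((contDiff_snd.comp contDiff_snd).mul hs)).sub contDiff_fst

theorem hasCompactSupport_twistIncr (s : ℝ) : HasCompactSupport (D.twistIncr s) := by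
  refine HasCompactSupport.intro (isCompact_closedBall 0 (5 + |D.vmax|)) fun p hp => ?_
  have h1 : D.Kmax < p.1 ^ 2 + p.2.2 ^ 2 ∨ D.vmax < |p.2.1| := by
    by_contra! h
    refine hp ?_
    have h4 := D.Kmax_le
    have h5 := abs_nonneg D.vmax
    have h6 := le_abs_self D.vmax
    rw [mem_closedBall_zero_iff, Prod.norm_def, Prod.norm_def, max_le_iff, max_le_iff]
    refine ⟨?_, ?_, ?_⟩ <;> rw [Real.norm_eq_abs]
    · refine abs_le_of_sq_le_sq ?_ (by positivity)
      nlinarith [sq_nonneg p.2.2]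
    · linarith
    · refine abs_le_of_sq_le_sq ?_ (by positivity)
      nlinarith [sq_nonneg p.1]
  have h2 := D.twist_eq_self_of 0 s (q := (![p.1, p.2.1], ![p.2.2, 0])) (by simpa using h1)
  have h3 := congrArg (fun q : Ph 2 => q.1 0) h2
  simp only [twist, Matrix.cons_val_zero, Matrix.cons_val_one] at h3
  simp only [twistIncr, h3, sub_self]

variable (k₁ k₂ : ℤ)

/-- The linear part of the first three frame coordinates. -/
def frameLin (n : ℤ) : Ph 2 →L[ℝ] ℝ × ℝ × ℝ :=
  let r (j : Fin 2) : Ph 2 →L[ℝ] ℝ :=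
    (ContinuousLinearMap.proj j).comp (ContinuousLinearMap.fst ℝ (Fin 2 → ℝ) (Fin 2 → ℝ))
  let θ (j : Fin 2) : Ph 2 →L[ℝ] ℝ :=
    (ContinuousLinearMap.proj j).comp (ContinuousLinearMap.snd ℝ (Fin 2 → ℝ) (Fin 2 → ℝ))
  ((D.a n)⁻¹ • r 0).prod ((r 1 - (k₂ / k₁ : ℝ) • r 0).prod
    ((4 * (D.N / (2 * Real.pi)) : ℝ) • ((k₁ : ℝ) • θ 0 + (k₂ : ℝ) • θ 1)))

theorem frameLin_apply (n : ℤ) (q : Ph 2) : D.frameLin k₁ k₂ n q =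
    ((D.a n)⁻¹ * q.1 0, q.1 1 - (k₂ / k₁ : ℝ) * q.1 0,
      4 * (D.N / (2 * Real.pi)) * (k₁ * q.2 0 + k₂ * q.2 1)) := rfl

/-- The constant part of the first three frame coordinates. -/
def frameConst (n : ℤ) : ℝ × ℝ × ℝ :=
  (-(D.a n)⁻¹ * D.c₁ n, -D.c₂ n + (k₂ / k₁ : ℝ) * D.c₁ n, -4 * n)

theorem frameLin_add_frameConst (n : ℤ) (q : Ph 2) :
    D.frameLin k₁ k₂ n q + D.frameConst k₁ k₂ n =
      ((D.frame k₁ k₂ n q).1 0, (D.frame k₁ k₂ n q).1 1, (D.frame k₁ k₂ n q).2 0) := by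
  rw [frameLin_apply]
  simp only [frameConst, frame, cellAngle, Matrix.cons_val_zero, Matrix.cons_val_one,
    Prod.mk_add_mk, Prod.mk.injEq]
  refine ⟨?_, ?_, ?_⟩ <;> ring

theorem window_fst_zero (h : k₁ ≠ 0) (s : ℝ) (n : ℤ) (q : Ph 2) :
    (D.window k₁ k₂ s n q).1 0 - q.1 0 =
      D.a n * D.twistIncr s (D.frameLin k₁ k₂ n q + D.frameConst k₁ k₂ n) := by
  have h1 := congrArg (fun q : Ph 2 => q.1 0) (D.unframe_frame (k₂ := k₂) h n q)
  rw [frameLin_add_frameConst]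
  simp only [unframe, Matrix.cons_val_zero] at h1
  conv_lhs => rw [← h1]
  simp only [window, unframe, twist, twistIncr, Matrix.cons_val_zero]
  ring

theorem window_fst_one (h : k₁ ≠ 0) (s : ℝ) (n : ℤ) (q : Ph 2) :
    (D.window k₁ k₂ s n q).1 1 - q.1 1 =
      (k₂ / k₁ : ℝ) * ((D.window k₁ k₂ s n q).1 0 - q.1 0) := by
  have h1 := congrArg (fun q : Ph 2 => q.1 0) (D.unframe_frame (k₂ := k₂) h n q)
  have h2 := congrArg (fun q : Ph 2 => q.1 1) (D.unframe_frame (k₂ := k₂) h n q)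
  simp only [unframe, Matrix.cons_val_zero, Matrix.cons_val_one] at h1 h2
  conv_lhs => rw [← h2]
  conv_rhs => rw [← h1]
  simp only [window, unframe, twist, Matrix.cons_val_zero, Matrix.cons_val_one]
  ring

variable {k₁ k₂}

theorem quadHam_polarLift_cellMap (hB : 0 < B) (h : k₁ ≠ 0) (hbox : D.InBox k₁ k₂)
    (ω₁ ω₂ s : ℝ) (p : Ph 2) :
    quadHam ω₁ ω₂ (polarLift B (D.cellMap k₁ k₂ s) p) - quadHam ω₁ ω₂ p =
      ((k₁ * ω₁ + k₂ * ω₂) / k₁) * (actJ 0 (polarLift B (D.cellMap k₁ k₂ s) p) - actJ 0 p) := by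
  have h' : (k₁ : ℝ) ≠ 0 := by exact_mod_cast h
  by_cases hp : p ∈ Rtilde B
  · obtain ⟨q, hq, rfl⟩ := exists_polarMap_eq hB hp
    have hF := D.isLiftable_cellMap h hbox s
    have hq' := hF.mem_posAct hB hq
    rw [polarLift_polarMap hF hq, quadHam, quadHam, actJ_polarMap (hq 0).le,
      actJ_polarMap (hq 1).le, actJ_polarMap (hq' 0).le, actJ_polarMap (hq' 1).le]
    have h1 : (D.cellMap k₁ k₂ s q).1 1 - q.1 1 =
      (k₂ / k₁ : ℝ) * ((D.cellMap k₁ k₂ s q).1 0 - q.1 0) := D.window_fst_one k₁ k₂ h s _ q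
    rw [add_div, mul_div_cancel_left₀ _ h']
    linear_combination ω₂ * h1
  · rw [polarLift_of_notMem hp]; simp

end CellData

namespace CellData

variable {B : ℝ} (D : CellData B)

theorem exists_bound_a : ∃ M : ℝ, 0 ≤ M ∧ ∀ n, |D.a n| ≤ M ∧ |(D.a n)⁻¹| ≤ M := by
  refine ⟨∑ i ∈ Finset.range D.N, (|D.a i| + |(D.a i)⁻¹|),
    Finset.sum_nonneg fun i _ => by positivity, fun n => ?_⟩
  have hN : (0 : ℤ) < D.N := by exact_mod_cast D.N_pos
  have h1 := Int.emod_nonneg n hN.ne'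
  have h2 := Int.emod_lt_of_pos n hN
  obtain ⟨i, hi⟩ := Int.eq_ofNat_of_zero_le h1
  have h3 : D.a n = D.a i := by
    conv_lhs => rw [← Int.emod_add_mul_ediv n D.N, D.a_add, hi]
  have h4 := Finset.single_le_sum (f := fun i : ℕ => |D.a i| + |(D.a i)⁻¹|)
    (fun i _ => by positivity) (show i ∈ Finset.range D.N by rw [Finset.mem_range]; omega)
  rw [h3]
  exact ⟨by linarith [abs_nonneg (D.a i)⁻¹], by linarith [abs_nonneg (D.a i)]⟩

theorem exists_norm_frameLin_le : ∃ Λ : ℝ, 1 ≤ Λ ∧ ∀ k₁ k₂ : ℤ, k₁ ≠ 0 → ∀ n,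
    ‖D.frameLin k₁ k₂ n‖ ≤ Λ * max |(k₁ : ℝ)| |(k₂ : ℝ)| := by
  obtain ⟨M, hM0, hM⟩ := D.exists_bound_a
  refine ⟨M + 2 + 8 * D.N, by linarith [Nat.cast_nonneg (α := ℝ) D.N], fun k₁ k₂ h n => ?_⟩
  set k := max |(k₁ : ℝ)| |(k₂ : ℝ)| with hk
  have h1 : (1 : ℝ) ≤ |(k₁ : ℝ)| := by exact_mod_cast Int.one_le_abs h
  have hk₁ : |(k₁ : ℝ)| ≤ k := le_max_left _ _
  have hk₂ : |(k₂ : ℝ)| ≤ k := le_max_right _ _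
  have hN : (0 : ℝ) ≤ D.N := Nat.cast_nonneg _
  have hk1 : 1 ≤ k := h1.trans hk₁
  refine ContinuousLinearMap.opNorm_le_bound _ (by positivity) fun q => ?_
  have hr (j : Fin 2) : |q.1 j| ≤ ‖q‖ := (norm_le_pi_norm q.1 j).trans (norm_fst_le q)
  have hθ (j : Fin 2) : |q.2 j| ≤ ‖q‖ := (norm_le_pi_norm q.2 j).trans (norm_snd_le q)
  have hq := norm_nonneg q
  have hkq : ‖q‖ ≤ k * ‖q‖ := le_mul_of_one_le_left hq hk1
  have hkq0 : 0 ≤ k * ‖q‖ := by positivity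
  have hE : (M + 2 + 8 * D.N) * k * ‖q‖ = M * (k * ‖q‖) + 2 * (k * ‖q‖) + 8 * D.N * (k * ‖q‖) := by
    ring
  have p1 : 0 ≤ M * (k * ‖q‖) := by positivity
  have p2 : 0 ≤ 8 * (D.N : ℝ) * (k * ‖q‖) := by positivity
  rw [frameLin_apply, Prod.norm_def, Prod.norm_def, max_le_iff, max_le_iff, hE]
  simp only [Real.norm_eq_abs]
  refine ⟨?_, ?_, ?_⟩
  · rw [abs_mul]
    have := mul_le_mul (hM n).2 ((hr 0).trans hkq) (abs_nonneg _) hM0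
    linarith
  · have h2 : |(k₂ / k₁ : ℝ)| ≤ k := by
      rw [abs_div]
      exact (div_le_self (abs_nonneg _) h1).trans hk₂
    have h3 := abs_sub (q.1 1) ((k₂ / k₁ : ℝ) * q.1 0)
    rw [abs_mul] at h3
    have := mul_le_mul h2 (hr 0) (abs_nonneg _) (by linarith)
    linarith [hr 1]
  · have h2 : |(k₁ : ℝ) * q.2 0 + k₂ * q.2 1| ≤ 2 * (k * ‖q‖) := by
      refine (abs_add_le _ _).trans ?_
      rw [abs_mul, abs_mul]
      have e1 := mul_le_mul hk₁ (hθ 0) (abs_nonneg _) (by linarith)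
      have e2 := mul_le_mul hk₂ (hθ 1) (abs_nonneg _) (by linarith)
      linarith
    have h3 : |4 * (D.N / (2 * Real.pi))| ≤ 4 * (D.N : ℝ) := by
      rw [abs_of_nonneg (by positivity)]
      have : (D.N : ℝ) / (2 * Real.pi) ≤ D.N :=
        div_le_self hN (by linarith [Real.pi_gt_three])
      linarith
    rw [abs_mul]
    have := mul_le_mul h3 h2 (abs_nonneg _) (by positivity)
    linarith

theorem exists_norm_iteratedFDeriv_actJ_le (hB : 0 < B) {V Vinv : Ph 2 → Ph 2}
    (hV : IsSymplectomorphism V Vinv) (σ : ℝ) (s : ℕ) :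
    ∃ C : ℝ, 0 ≤ C ∧ ∀ k₁ k₂ : ℤ, k₁ ≠ 0 → D.InBox k₁ k₂ → ∀ z, ∀ m ≤ s,
      ‖iteratedFDeriv ℝ m (fun w => actJ 0 (polarLift B (D.cellMap k₁ k₂ σ) (Vinv w)) -
        actJ 0 (Vinv w)) z‖ ≤ C * max |(k₁ : ℝ)| |(k₂ : ℝ)| ^ s := by
  have hK : IsCompact (V '' Rtilde B) := (isCompact_Rtilde B).image hV.smooth.continuous
  obtain ⟨Ma, hMa0, hMa⟩ := D.exists_bound_a
  obtain ⟨Λ, hΛ1, hΛ⟩ := D.exists_norm_frameLin_le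
  obtain ⟨Cg, hCg0, hCg⟩ := exists_norm_iteratedFDeriv_le_of_hasCompactSupport s
    ((D.contDiff_twistIncr σ).of_le (by exact_mod_cast le_top)) (D.hasCompactSupport_twistIncr σ)
  have key : ∃ C : ℝ, 0 ≤ C ∧ ∀ z ∈ V '' Rtilde B, ∀ k₁ k₂ : ℤ, k₁ ≠ 0 → D.InBox k₁ k₂ → ∀ m ≤ s,
      ‖iteratedFDeriv ℝ m (fun w => actJ 0 (polarLift B (D.cellMap k₁ k₂ σ) (Vinv w)) -
        actJ 0 (Vinv w)) z‖ ≤ C * max |(k₁ : ℝ)| |(k₂ : ℝ)| ^ s := by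
    refine hK.induction_on (p := fun S => ∃ C : ℝ, 0 ≤ C ∧ ∀ z ∈ S, ∀ k₁ k₂ : ℤ, k₁ ≠ 0 →
      D.InBox k₁ k₂ → ∀ m ≤ s,
      ‖iteratedFDeriv ℝ m (fun w => actJ 0 (polarLift B (D.cellMap k₁ k₂ σ) (Vinv w)) -
        actJ 0 (Vinv w)) z‖ ≤ C * max |(k₁ : ℝ)| |(k₂ : ℝ)| ^ s) ?_ ?_ ?_ ?_
    · exact ⟨0, le_rfl, fun z hz => hz.elim⟩
    · rintro S T hST ⟨C, hC0, hC⟩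
      exact ⟨C, hC0, fun z hz => hC z (hST hz)⟩
    · rintro S T ⟨C, hC0, hC⟩ ⟨C', hC0', hC'⟩
      refine ⟨C + C', by positivity, ?_⟩
      rintro z (hz | hz) k₁ k₂ h hb m hm
      · refine (hC z hz k₁ k₂ h hb m hm).trans ?_
        gcongr
        linarith
      · refine (hC' z hz k₁ k₂ h hb m hm).trans ?_
        gcongr
        linarith
    · rintro z₀ ⟨p, hp, rfl⟩
      obtain ⟨q, hq, hqp⟩ := exists_polarMap_eq hB hp
      obtain ⟨g, hg, hgs, hgr⟩ := exists_local_polarSection hq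
      have hVp : Vinv (V p) = polarMap q := by rw [hV.left_inv, hqp]
      have hh : ContDiffAt ℝ (⊤ : ℕ∞) (fun w => g (Vinv w)) (V p) := by
        refine ContDiffAt.comp (V p) (g := g) ?_ hV.smooth_inv.contDiffAt
        rwa [hVp]
      obtain ⟨W, hWo, hzW, hWc, M, hM1, hM⟩ :=
        (hh.of_le (m := s) (by exact_mod_cast le_top)).exists_open_norm_iteratedFDeriv_le
      have hVc : ContinuousAt Vinv (V p) := hV.smooth_inv.continuous.continuousAt
      have h1 : ∀ᶠ w in 𝓝 (V p), polarMap (g (Vinv w)) = Vinv w ∧ g (Vinv w) ∈ posAct := by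
        refine (hVc.eventually (by rwa [hVp])).and
          (hh.continuousAt.eventually_mem (isOpen_posAct.mem_nhds ?_))
        simp only [hVp, hg, hq]
      obtain ⟨W', hW', hWo', hzW'⟩ := _root_.eventually_nhds_iff.1 h1
      refine ⟨W ∩ W', mem_nhdsWithin_of_mem_nhds
        ((hWo.inter hWo').mem_nhds ⟨hzW, hzW'⟩),
        Ma * (s.factorial * Cg * (Λ * M) ^ s), by positivity, ?_⟩
      rintro z ⟨hz, hz'⟩ k₁ k₂ h hb m hm
      set k := max |(k₁ : ℝ)| |(k₂ : ℝ)| with hk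
      have hk1 : 1 ≤ k := le_max_of_le_left (by exact_mod_cast Int.one_le_abs h)
      set n := round (D.cellAngle k₁ k₂ (g (Vinv z))) with hn
      have hgc : ContinuousAt (fun w => g (Vinv w)) z := hWc.continuousOn.continuousAt (hWo.mem_nhds hz)
      have hF := D.isLiftable_cellMap h hb σ
      have heq : (fun w => actJ 0 (polarLift B (D.cellMap k₁ k₂ σ) (Vinv w)) - actJ 0 (Vinv w))
          =ᶠ[𝓝 z] fun w => D.a n • D.twistIncr σ
            (D.frameLin k₁ k₂ n (g (Vinv w)) + D.frameConst k₁ k₂ n) := by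
        filter_upwards [hWo'.mem_nhds hz', hgc.eventually (D.cellMap_eventuallyEq h σ _)]
          with w hw hw2
        obtain ⟨hw3, hw4⟩ := hW' w hw
        rw [← hw3, polarLift_polarMap hF hw4, actJ_polarMap (hw4 0).le,
          actJ_polarMap (hF.mem_posAct hB hw4 0).le, hw3, hw2, D.window_fst_zero k₁ k₂ h]
        rfl
      have hms : (m : WithTop ℕ∞) ≤ s := by exact_mod_cast hm
      have htw : ContDiff ℝ m (D.twistIncr σ) := (D.contDiff_twistIncr σ).of_le
        (by exact_mod_cast le_top)
      have hsm : ContDiffAt ℝ m (fun w => D.twistIncr σ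
            (D.frameLin k₁ k₂ n (g (Vinv w)) + D.frameConst k₁ k₂ n)) z := by
        refine htw.contDiffAt.comp z (ContDiffAt.add ?_ contDiffAt_const)
        exact (D.frameLin k₁ k₂ n).contDiff.contDiffAt.comp z
          ((hWc.of_le hms).contDiffAt (hWo.mem_nhds hz))
      rw [(heq.iteratedFDeriv ℝ m).self_of_nhds, iteratedFDeriv_const_smul_apply' hsm, norm_smul, Real.norm_eq_abs]
      have hb2 := norm_iteratedFDeriv_comp_affine_le hWo (n := m) htw (hWc.of_le hms)
        (D.frameLin k₁ k₂ n) (D.frameConst k₁ k₂ n) hz (C := Cg) (M := M) (Λ := Λ * k) hM1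
        (one_le_mul_of_one_le_of_one_le hΛ1 hk1) (hΛ k₁ k₂ h n)
        (fun i hi => hCg i (hi.trans hm)) (fun i hi => hM z hz i (hi.trans hm))
      have hb3 : (m.factorial : ℝ) * Cg * (Λ * k * M) ^ m ≤ s.factorial * Cg * (Λ * k * M) ^ s := by
        gcongr
        · exact one_le_mul_of_one_le_of_one_le (one_le_mul_of_one_le_of_one_le hΛ1 hk1) hM1
      calc |D.a n| * _ ≤ Ma * (s.factorial * Cg * (Λ * k * M) ^ s) :=
            mul_le_mul (hMa n).1 (hb2.trans hb3) (norm_nonneg _) hMa0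
        _ = _ := by rw [mul_right_comm, mul_pow]; ring
  obtain ⟨C, hC0, hC⟩ := key
  refine ⟨C, hC0, fun k₁ k₂ h hb z m hm => ?_⟩
  by_cases hz : z ∈ V '' Rtilde B
  · exact hC z hz k₁ k₂ h hb m hm
  · have heq : (fun w => actJ 0 (polarLift B (D.cellMap k₁ k₂ σ) (Vinv w)) - actJ 0 (Vinv w))
        =ᶠ[𝓝 z] fun _ => 0 := by
      have : Vinv z ∉ Rtilde B := fun h => hz ⟨_, h, hV.right_inv z⟩
      have h2 := hV.smooth_inv.continuous.continuousAt.eventually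
        ((isClosed_Rtilde B).isOpen_compl.mem_nhds this)
      filter_upwards [h2] with w hw
      rw [polarLift_of_notMem hw, sub_self]
    rw [(heq.iteratedFDeriv ℝ m).self_of_nhds]
    have : iteratedFDeriv ℝ m (fun _ : Ph 2 => (0 : ℝ)) z = 0 := by
      simp
    rw [this, norm_zero]
    positivity

end CellData

/-- A cut-off function equal to `1` on `[-δ, δ]` and to `0` outside `[-2δ, 2δ]`. -/
def bumpProfile (δ v : ℝ) : ℝ := Real.smoothTransition ((4 * δ ^ 2 - v ^ 2) / (3 * δ ^ 2))

/-- A function with derivative `π / 2` below `1 + η` and vanishing above `1 + 2η`. -/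
def angleProfile (η K : ℝ) : ℝ :=
  Real.pi / 2 * (K - 2) * Real.smoothTransition ((1 + 2 * η - K) / η)

theorem contDiff_bumpProfile (δ : ℝ) : ContDiff ℝ (⊤ : ℕ∞) (bumpProfile δ) :=
  Real.smoothTransition.contDiff.comp
    (ContDiff.div_const (contDiff_const.sub (contDiff_id.pow 2)) _)

theorem contDiff_angleProfile (η : ℝ) : ContDiff ℝ (⊤ : ℕ∞) (angleProfile η) :=
  (contDiff_const.mul (contDiff_id.sub contDiff_const)).mul
    (Real.smoothTransition.contDiff.comp (ContDiff.div_const (contDiff_const.sub contDiff_id) _))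

theorem bumpProfile_eq_one {δ v : ℝ} (hδ : 0 < δ) (h : |v| ≤ δ) : bumpProfile δ v = 1 := by
  refine Real.smoothTransition.one_of_one_le ?_
  rw [le_div_iff₀ (by positivity)]
  nlinarith [sq_abs v, abs_nonneg v]

theorem bumpProfile_eq_zero {δ v : ℝ} (hδ : 0 < δ) (h : 2 * δ < |v|) : bumpProfile δ v = 0 := by
  refine Real.smoothTransition.zero_of_nonpos ?_
  refine div_nonpos_of_nonpos_of_nonneg ?_ (by positivity)
  nlinarith [sq_abs v, abs_nonneg v]

theorem angleProfile_eq_zero {η K : ℝ} (hη : 0 < η) (h : 1 + 2 * η < K) :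
    angleProfile η K = 0 := by
  rw [angleProfile, Real.smoothTransition.zero_of_nonpos, mul_zero]
  exact div_nonpos_of_nonpos_of_nonneg (by linarith) hη.le

theorem deriv_angleProfile {η K : ℝ} (hη : 0 < η) (h : K < 1 + η) :
    deriv (angleProfile η) K = Real.pi / 2 := by
  have : angleProfile η =ᶠ[𝓝 K] fun K => Real.pi / 2 * (K - 2) := by
    filter_upwards [Iio_mem_nhds h] with x hx
    rw [angleProfile, Real.smoothTransition.one_of_one_le, mul_one]
    rw [le_div_iff₀ hη]
    linarith [mem_Iio.1 hx]
  rw [this.deriv_eq]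
  simp

/-- The segment `c + [-a, a] (1, σ)` lies in `[l, h]²` and reaches its boundary;
`w = (c₁, c₂, a)`. -/
structure IsSegment (l h σ : ℝ) (w : ℝ × ℝ × ℝ) : Prop where
  pos : 0 < w.2.2
  fst_mem : ∀ e : ℝ, |e| ≤ 1 → w.1 + w.2.2 * e ∈ Icc l h
  snd_mem : ∀ e : ℝ, |e| ≤ 1 → w.2.1 + σ * (w.2.2 * e) ∈ Icc l h
  exits : ∃ e : ℝ, |e| = 1 ∧ (w.1 + w.2.2 * e ∈ ({l, h} : Set ℝ) ∨
    w.2.1 + σ * (w.2.2 * e) ∈ ({l, h} : Set ℝ))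

theorem exists_isSegment {l h σ c₁ c₂ : ℝ} (hσ : σ ≠ 0) (h1 : c₁ ∈ Ioo l h) (h2 : c₂ ∈ Ioo l h) :
    ∃ a, IsSegment l h σ (c₁, c₂, a) := by
  have hσ' : 0 < |σ| := abs_pos.2 hσ
  set a₁ := min (c₁ - l) (h - c₁) with ha₁
  set a₂ := min (c₂ - l) (h - c₂) with ha₂
  have p1 : 0 < a₁ := lt_min (by linarith [h1.1]) (by linarith [h1.2])
  have p2 : 0 < a₂ := lt_min (by linarith [h2.1]) (by linarith [h2.2])
  have key (c b x : ℝ) (hc : b ≤ min (c - l) (h - c)) (hx : |x| ≤ b) : c + x ∈ Icc l h := by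
    have := abs_le.1 hx
    have := le_min_iff.1 hc
    constructor <;> linarith
  have key2 (c : ℝ) : ∃ e : ℝ, |e| = 1 ∧ c + min (c - l) (h - c) * e ∈ ({l, h} : Set ℝ) := by
    rcases min_choice (c - l) (h - c) with hm | hm
    · exact ⟨-1, by simp, .inl (by rw [hm]; ring)⟩
    · exact ⟨1, by simp, .inr (by rw [hm, mem_singleton_iff]; ring)⟩
  refine ⟨min a₁ (a₂ / |σ|), lt_min p1 (by positivity), fun e he => ?_, fun e he => ?_, ?_⟩
  · refine key _ a₁ _ le_rfl ?_
    rw [abs_mul, abs_of_pos (lt_min p1 (by positivity))]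
    exact (mul_le_of_le_one_right (lt_min p1 (by positivity)).le he).trans (min_le_left _ _)
  · refine key _ a₂ _ le_rfl ?_
    rw [abs_mul, abs_mul, abs_of_pos (lt_min p1 (by positivity : 0 < a₂ / |σ|))]
    have : min a₁ (a₂ / |σ|) * |e| ≤ a₂ / |σ| :=
      (mul_le_of_le_one_right (lt_min p1 (by positivity)).le he).trans (min_le_right _ _)
    calc |σ| * (min a₁ (a₂ / |σ|) * |e|) ≤ |σ| * (a₂ / |σ|) := by gcongr
      _ = a₂ := by field_simp
  · rcases min_choice a₁ (a₂ / |σ|) with hm | hm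
    · obtain ⟨e, he, h3⟩ := key2 c₁
      exact ⟨e, he, .inl (by simp only [hm]; exact h3)⟩
    · obtain ⟨e, he, h3⟩ := key2 c₂
      refine ⟨e * SignType.sign σ, ?_, .inr ?_⟩
      · rw [abs_mul, he, one_mul]
        rcases hσ.lt_or_gt with hs | hs <;> simp [hs]
      · have : σ * (a₂ / |σ| * (e * SignType.sign σ)) = a₂ * e := by
          rcases hσ.lt_or_gt with hs | hs
          · simp [hs, abs_of_neg hs]; field_simp
          · simp [hs, abs_of_pos hs]; field_simp
        simp only [hm]
        rw [this]
        exact h3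

/-- The segment starts at the corner `(l, l)`. -/
theorem exists_isSegment_corner {l h σ : ℝ} (hσ : 0 < σ) (hlh : l < h) :
    ∃ w, IsSegment l h σ w ∧ w.1 - w.2.2 = l ∧ w.2.1 - σ * w.2.2 = l ∧
      (w.1 + w.2.2 = h ∨ w.2.1 + σ * w.2.2 = h) := by
  set m := max 1 σ with hm
  have hm1 : 1 ≤ m := le_max_left _ _
  have hmσ : σ ≤ m := le_max_right _ _
  set a := (h - l) / (2 * m) with ha
  have hma : 2 * (m * a) = h - l := by rw [ha]; field_simp
  have pa : 0 < a := by rw [ha]; exact div_pos (by linarith) (by linarith)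
  have ham : a ≤ m * a := le_mul_of_one_le_left pa.le hm1
  have hσm : σ * a ≤ m * a := mul_le_mul_of_nonneg_right hmσ pa.le
  have hσa : 0 < σ * a := by positivity
  have hend : l + a + a = h ∨ l + σ * a + σ * a = h := by
    rcases max_choice 1 σ with h1 | h1
    · left; rw [← hm] at h1; rw [h1] at hma; linarith
    · right; rw [← hm] at h1; rw [h1] at hma; linarith
  refine ⟨(l + a, l + σ * a, a), ⟨pa, fun e he => ?_, fun e he => ?_, 1, by simp, ?_⟩, ?_, ?_, hend⟩
  · have := abs_le.1 he
    constructor <;> simp only <;> nlinarith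
  · have := abs_le.1 he
    constructor <;> simp only <;> nlinarith
  · simp only [mul_one]
    rcases hend with h1 | h1
    · exact .inl (.inr h1)
    · exact .inr (.inr h1)
  · simp
  · simp

/-- The point `r` is close enough to the centre of the segment `w`. -/
def IsNearCentre (η δ σ : ℝ) (w : ℝ × ℝ × ℝ) (r : ℝ × ℝ) : Prop :=
  (r.1 - w.1) ^ 2 < η * w.2.2 ^ 2 ∧ |r.2 - w.2.1| + (|σ| + 1) * |r.1 - w.1| < δ

theorem exists_list_isSegment {l h i A σ η δ : ℝ} (hσ : σ ≠ 0) (hl : l < i) (hiA : i ≤ A)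
    (hh : A < h) (hη : 0 < η) (hδ : 0 < δ) :
    ∃ L : List (ℝ × ℝ × ℝ), (∀ w ∈ L, IsSegment l h σ w) ∧
      (∀ r : ℝ × ℝ, r.1 ∈ Icc i A → r.2 ∈ Icc i A → ∃ w ∈ L, IsNearCentre η δ σ w r) ∧
      (0 < σ → ∃ w ∈ L, w.1 - w.2.2 = l ∧ w.2.1 - σ * w.2.2 = l ∧
        (w.1 + w.2.2 = h ∨ w.2.1 + σ * w.2.2 = h)) := by
  have h1 : ∀ c : ℝ × ℝ, ∃ a : ℝ, c ∈ Icc i A ×ˢ Icc i A → IsSegment l h σ (c.1, c.2, a) := by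
    intro c
    by_cases hc : c ∈ Icc i A ×ˢ Icc i A
    · obtain ⟨a, ha⟩ := exists_isSegment hσ (l := l) (h := h)
        ⟨hl.trans_le hc.1.1, hc.1.2.trans_lt hh⟩ ⟨hl.trans_le hc.2.1, hc.2.2.trans_lt hh⟩
      exact ⟨a, fun _ => ha⟩
    · exact ⟨0, fun h => absurd h hc⟩
  choose a ha using h1
  have hU (c : ℝ × ℝ) (hc : c ∈ Icc i A ×ˢ Icc i A) :
      {r | IsNearCentre η δ σ (c.1, c.2, a c) r} ∈ 𝓝 c := by
    have hpos := (ha c hc).pos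
    have o1 : IsOpen {r : ℝ × ℝ | (r.1 - c.1) ^ 2 < η * a c ^ 2} :=
      isOpen_lt (by fun_prop) (by fun_prop)
    have o2 : IsOpen {r : ℝ × ℝ | |r.2 - c.2| + (|σ| + 1) * |r.1 - c.1| < δ} :=
      isOpen_lt (by fun_prop) (by fun_prop)
    refine (o1.inter o2).mem_nhds ⟨?_, ?_⟩
    · have : 0 < η * a c ^ 2 := mul_pos hη (pow_pos hpos 2)
      simpa using this
    · simpa using hδ
  obtain ⟨t, ht, hcov⟩ := (isCompact_Icc.prod isCompact_Icc).elim_nhds_subcover _ hU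
  set L := t.toList.map fun c => (c.1, c.2, a c) with hL
  have hL1 : ∀ w ∈ L, IsSegment l h σ w := by
    intro w hw
    obtain ⟨c, hc, rfl⟩ := List.mem_map.1 hw
    exact ha c (ht c (Finset.mem_toList.1 hc))
  have hL2 : ∀ r : ℝ × ℝ, r.1 ∈ Icc i A → r.2 ∈ Icc i A → ∃ w ∈ L, IsNearCentre η δ σ w r := by
    intro r h1 h2
    obtain ⟨c, hc, hr⟩ := mem_iUnion₂.1 (hcov (show r ∈ Icc i A ×ˢ Icc i A from ⟨h1, h2⟩))
    exact ⟨_, List.mem_map.2 ⟨c, Finset.mem_toList.2 hc, rfl⟩, hr⟩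
  by_cases hs : 0 < σ
  · obtain ⟨w, hw, hw2⟩ := exists_isSegment_corner (l := l) (h := h) hs (by linarith)
    refine ⟨w :: L, fun w' hw' => ?_, fun r h1 h2 => ?_, fun _ => ⟨w, by simp, hw2⟩⟩
    · rcases List.mem_cons.1 hw' with rfl | hw'
      exacts [hw, hL1 _ hw']
    · obtain ⟨w', hw', h3⟩ := hL2 r h1 h2
      exact ⟨w', by simp [hw'], h3⟩
  · exact ⟨L, hL1, hL2, fun h => absurd h hs⟩

namespace CellData

/-- The cells attached to the segments of a list. -/
def ofList (B η δ : ℝ) (hη : 0 < η) (hη' : η ≤ 3 / 4) (hδ : 0 < δ) (L : List (ℝ × ℝ × ℝ))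
    (hL : 0 < L.length) (ha : ∀ w ∈ L, w.2.2 ≠ 0) : CellData B where
  N := L.length
  N_pos := hL
  c₁ n := (L.getD (n % L.length).toNat 0).1
  c₂ n := (L.getD (n % L.length).toNat 0).2.1
  a n := (L.getD (n % L.length).toNat 0).2.2
  a_ne n := by
    have h1 := Int.emod_nonneg n (b := L.length) (by omega)
    have h2 := Int.emod_lt_of_pos n (b := L.length) (by omega)
    rw [List.getD_eq_getElem _ _ (show (n % L.length).toNat < L.length by omega)]
    exact ha _ (List.getElem_mem _)
  c₁_add n m := by rw [Int.add_mul_emod_self_left]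
  c₂_add n m := by rw [Int.add_mul_emod_self_left]
  a_add n m := by rw [Int.add_mul_emod_self_left]
  τ := angleProfile η
  χ := bumpProfile δ
  contDiff_τ := contDiff_angleProfile η
  contDiff_χ := contDiff_bumpProfile δ
  Kmax := 1 + 2 * η
  vmax := 2 * δ
  Kmax_le := by linarith
  τ_eq _ h := angleProfile_eq_zero hη h
  χ_eq _ h := bumpProfile_eq_zero hδ h

theorem cellMap_eq_self_of_cellAngle {B : ℝ} (D : CellData B) {k₁ k₂ : ℤ} (h : k₁ ≠ 0) (s : ℝ)
    {q : Ph 2} (hq : D.cellAngle k₁ k₂ q = 1 / 2) : D.cellMap k₁ k₂ s q = q := by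
  rw [D.cellMap_eq_window h s (n := 0), D.window_eq_self_of_far h] <;> rw [hq] <;> norm_num

theorem exists_cellAngle_eq {B : ℝ} (D : CellData B) {k₁ : ℤ} (k₂ : ℤ) (h : k₁ ≠ 0) (x : ℝ)
    (r : Fin 2 → ℝ) : ∃ θ, D.cellAngle k₁ k₂ (r, θ) = x := by
  have h' : (k₁ : ℝ) ≠ 0 := by exact_mod_cast h
  have hN := D.N_ne
  have hπ := Real.pi_ne_zero
  refine ⟨![x * (2 * Real.pi / D.N) / k₁, 0], ?_⟩
  simp [cellAngle]
  field_simp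

theorem exists_cellMap_eq_self {B : ℝ} (D : CellData B) {k₁ : ℤ} (k₂ : ℤ) (h : k₁ ≠ 0) (s : ℝ)
    (r : Fin 2 → ℝ) : ∃ θ, D.cellMap k₁ k₂ s (r, θ) = (r, θ) :=
  let ⟨θ, hθ⟩ := D.exists_cellAngle_eq k₂ h (1 / 2) r
  ⟨θ, D.cellMap_eq_self_of_cellAngle h s hθ⟩

theorem exists_cellMap_fst {B : ℝ} (D : CellData B) {k₁ : ℤ} (k₂ : ℤ) (h : k₁ ≠ 0) {η δ : ℝ}
    (hη : 0 < η) (hδ : 0 < δ) (hτ : D.τ = angleProfile η) (hχ : D.χ = bumpProfile δ) (n : ℤ)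
    {e : ℝ} (he : |e| = 1) (r : Fin 2 → ℝ) (h1 : (r 0 - D.c₁ n) ^ 2 < η * D.a n ^ 2)
    (h2 : |(r 1 - D.c₂ n) - (k₂ / k₁ : ℝ) * (r 0 - D.c₁ n)| ≤ δ) :
    ∃ θ, (D.cellMap k₁ k₂ 1 (r, θ)).1 0 = D.c₁ n + D.a n * e ∧
      (D.cellMap k₁ k₂ 1 (r, θ)).1 1 = D.c₂ n + ((r 1 - D.c₂ n) -
        (k₂ / k₁ : ℝ) * (r 0 - D.c₁ n)) + (k₂ / k₁ : ℝ) * (D.a n * e) := by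
  obtain ⟨θ, hθ⟩ := D.exists_cellAngle_eq k₂ h (n - e / 4) r
  have ha : 0 < D.a n ^ 2 := by have := D.a_ne n; positivity
  have he2 : e ^ 2 = 1 := by rw [← sq_abs, he]; norm_num
  have hK : deriv D.τ ((D.frame k₁ k₂ n (r, θ)).1 0 ^ 2 + (D.frame k₁ k₂ n (r, θ)).2 0 ^ 2) =
      Real.pi / 2 := by
    rw [hτ]
    refine deriv_angleProfile hη ?_
    rw [frame_snd_zero, hθ]
    simp only [frame, Matrix.cons_val_zero, div_pow]
    have := (div_lt_iff₀ ha).2 h1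
    nlinarith
  have hv : D.χ ((D.frame k₁ k₂ n (r, θ)).1 1) = 1 := by
    rw [hχ]
    exact bumpProfile_eq_one hδ h2
  refine ⟨θ, ?_⟩
  rw [D.cellMap_eq_window h 1 (n := n)]
  · simp only [window, unframe, twist, Matrix.cons_val_zero, Matrix.cons_val_one]
    rw [hK, hv, frame_snd_zero, hθ]
    simp only [one_mul, mul_one, Real.cos_pi_div_two, Real.sin_pi_div_two, frame,
      Matrix.cons_val_one, Matrix.cons_val_zero]
    constructor <;> ring
  · rw [hθ, sub_sub_cancel_left, abs_neg, abs_div, he]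
    norm_num [abs_of_pos]

end CellData

theorem IsSegment.mem_Icc_of_near {A i σ σ' c₁ c₂ a X v : ℝ} (hA : 1 ≤ A) (hi : i = A⁻¹)
    (hw : IsSegment (3 / 4 * i) (3 / 2 * A) σ (c₁, c₂, a)) (ha1 : a ≤ 3 / 4 * A)
    (ha2 : |σ| * a ≤ 3 / 4 * A) (hp : |σ' - σ| * a ≤ 3 / 256 * i)
    (hX : X ^ 2 ≤ 1 + 2 * (i ^ 2 / 16)) (hv : |v| ≤ 2 * (i / 32)) :
    c₁ + a * X ∈ Icc (2 * A)⁻¹ (2 * A) ∧ c₂ + v + σ' * (a * X) ∈ Icc (2 * A)⁻¹ (2 * A) := by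
  have hA0 : 0 < A := by linarith
  have hi0 : 0 < i := hi ▸ inv_pos.2 hA0
  have hiA : i * A = 1 := hi ▸ inv_mul_cancel₀ hA0.ne'
  have hi1 : i ≤ 1 := hi ▸ inv_le_one_of_one_le₀ hA
  have hη : 0 < i ^ 2 / 16 := by positivity
  have hX1 : |X| ≤ 1 + i ^ 2 / 16 := abs_le_of_sq_le_sq (by nlinarith) (by positivity)
  have ha := hw.pos
  set ζ := 1 + i ^ 2 / 16 with hζ
  have hζ0 : 0 < ζ := by positivity
  obtain ⟨e, he, rfl⟩ : ∃ e : ℝ, |e| ≤ 1 ∧ X = e * ζ :=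
    ⟨X / ζ, by rwa [abs_div, abs_of_pos hζ0, div_le_one hζ0], (div_mul_cancel₀ _ hζ0.ne').symm⟩
  have f := hw.fst_mem e he
  have g := hw.snd_mem e he
  simp only [mem_Icc] at f g ha
  have b1 : |a * e * (i ^ 2 / 16)| ≤ 3 / 64 * i := by
    rw [abs_mul, abs_mul, abs_of_pos ha, abs_of_pos hη]
    have : a * |e| ≤ 3 / 4 * A := by nlinarith [abs_nonneg e]
    nlinarith
  have b2 : |σ * (a * e) * (i ^ 2 / 16)| ≤ 3 / 64 * i := by
    rw [abs_mul, abs_mul, abs_mul, abs_of_pos ha, abs_of_pos hη]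
    have : |σ| * (a * |e|) ≤ 3 / 4 * A := by
      rw [← mul_assoc]
      nlinarith [abs_nonneg e, mul_nonneg (abs_nonneg σ) ha.le]
    nlinarith
  have b3 : |(σ' - σ) * (a * (e * ζ))| ≤ 3 / 128 * i := by
    rw [abs_mul, abs_mul, abs_of_pos ha, ← mul_assoc]
    have h0 : 0 ≤ |σ' - σ| * a := by positivity
    have : |e * ζ| ≤ 2 := by nlinarith
    nlinarith [abs_nonneg (e * ζ)]
  have b1' := abs_le.1 b1
  have b2' := abs_le.1 b2
  have b3' := abs_le.1 b3
  have b4' := abs_le.1 hv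
  have e1 : a * (e * ζ) = a * e + a * e * (i ^ 2 / 16) := by rw [hζ]; ring
  have e2 : σ' * (a * (e * ζ)) = σ * (a * e) + σ * (a * e) * (i ^ 2 / 16) +
      (σ' - σ) * (a * (e * ζ)) := by rw [hζ]; ring
  have e3 : (2 * A)⁻¹ = i / 2 := by rw [mul_inv, ← hi]; ring
  rw [e3, e2]
  constructor
  · rw [e1]
    exact ⟨by linarith, by linarith⟩
  · exact ⟨by linarith, by linarith⟩

theorem exists_cellData {A : ℝ} (hA : 1 ≤ A) {σ : ℝ} (hσ : σ ≠ 0) :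
    ∃ D : CellData (2 * A), ∃ ρ > 0, ∀ k₁ k₂ : ℤ, k₁ ≠ 0 → |(k₂ / k₁ : ℝ) - σ| ≤ ρ →
      D.InBox k₁ k₂ ∧
      (∀ r : Fin 2 → ℝ, r 0 ∈ Icc A⁻¹ A → r 1 ∈ Icc A⁻¹ A → ∃ θ,
        ¬ ((D.cellMap k₁ k₂ 1 (r, θ)).1 0 ∈ Icc A⁻¹ A ∧
          (D.cellMap k₁ k₂ 1 (r, θ)).1 1 ∈ Icc A⁻¹ A)) ∧
      (0 < σ → ∃ r : Fin 2 → ℝ, (∀ j, 0 < r j) ∧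
        (∃ θ, (D.cellMap k₁ k₂ 1 (r, θ)).1 0 < A⁻¹ ∧ (D.cellMap k₁ k₂ 1 (r, θ)).1 1 < A⁻¹) ∧
        ∃ θ, A < (D.cellMap k₁ k₂ 1 (r, θ)).1 0 ∨ A < (D.cellMap k₁ k₂ 1 (r, θ)).1 1) := by
  set i := A⁻¹ with hi
  have hA0 : 0 < A := by linarith
  have hi0 : 0 < i := inv_pos.2 hA0
  have hiA : i * A = 1 := inv_mul_cancel₀ hA0.ne'
  have hi1 : i ≤ 1 := inv_le_one_of_one_le₀ hA
  have hη : 0 < i ^ 2 / 16 := by positivity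
  have hδ : 0 < i / 32 := by positivity
  obtain ⟨L, hL1, hL2, hL3⟩ := exists_list_isSegment (l := 3 / 4 * i) (h := 3 / 2 * A) (i := i)
    (A := A) hσ (by linarith) (by linarith) (by linarith) hη hδ
  have hL0 : 0 < L.length := by
    obtain ⟨w, hw, -⟩ := hL2 (1, 1) ⟨hi1, hA⟩ ⟨hi1, hA⟩
    exact List.length_pos_of_mem hw
  set D := CellData.ofList (2 * A) (i ^ 2 / 16) (i / 32) hη (by nlinarith) hδ L hL0
    (fun w hw => (hL1 w hw).pos.ne') with hD
  have hseg (n : ℤ) : IsSegment (3 / 4 * i) (3 / 2 * A) σ (D.c₁ n, D.c₂ n, D.a n) := by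
    have h1 := Int.emod_nonneg n (b := L.length) (by omega)
    have h2 := Int.emod_lt_of_pos n (b := L.length) (by omega)
    refine hL1 (L.getD (n % L.length).toNat 0) ?_
    rw [List.getD_eq_getElem _ _ (show (n % L.length).toNat < L.length by omega)]
    exact List.getElem_mem _
  have hidx : ∀ w ∈ L, ∃ n : ℤ, (D.c₁ n, D.c₂ n, D.a n) = w := by
    intro w hw
    obtain ⟨j, hj, rfl⟩ := List.getElem_of_mem hw
    refine ⟨j, ?_⟩
    show L.getD ((j : ℤ) % L.length).toNat 0 = L[j]
    rw [← List.getD_eq_getElem L 0 hj]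
    congr 1
    rw [Int.emod_eq_of_lt (by omega) (by omega)]
    simp
  have hsmall (n : ℤ) : D.a n ≤ 3 / 4 * A ∧ |σ| * D.a n ≤ 3 / 4 * A := by
    have f1 := (hseg n).fst_mem 1 (by simp)
    have f2 := (hseg n).fst_mem (-1) (by simp)
    have s1 := (hseg n).snd_mem 1 (by simp)
    have s2 := (hseg n).snd_mem (-1) (by simp)
    simp only [mem_Icc] at f1 f2 s1 s2
    refine ⟨by linarith, ?_⟩
    rcases abs_cases σ with ⟨h, -⟩ | ⟨h, -⟩ <;> rw [h] <;> nlinarith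
  refine ⟨D, i ^ 2 / 64, by positivity, fun k₁ k₂ h hk => ?_⟩
  set σ' : ℝ := k₂ / k₁ with hσ'
  have hpert (n : ℤ) : |σ' - σ| * D.a n ≤ 3 / 256 * i := by
    have := mul_le_mul hk (hsmall n).1 (hseg n).pos.le (by positivity)
    nlinarith
  refine ⟨fun n X v hX hv => ?_, fun r h0 h1 => ?_, fun hs => ?_⟩
  · have hX : X ^ 2 ≤ 1 + 2 * (i ^ 2 / 16) := hX
    have hv : |v| ≤ 2 * (i / 32) := hv
    exact (hseg n).mem_Icc_of_near hA hi (hsmall n).1 (hsmall n).2 (hpert n) hX hv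
  · obtain ⟨w, hw, hr1, hr2⟩ := hL2 (r 0, r 1) h0 h1
    obtain ⟨n, rfl⟩ := hidx w hw
    obtain ⟨e, he, hex⟩ := (hseg n).exits
    simp only at hr1 hr2 hex
    have hv : |(r 1 - D.c₂ n) - σ' * (r 0 - D.c₁ n)| ≤ i / 32 := by
      refine (abs_sub _ _).trans (le_trans ?_ hr2.le)
      rw [abs_mul]
      gcongr
      have := abs_sub_abs_le_abs_sub σ' σ
      nlinarith
    obtain ⟨θ, e0, e1⟩ := D.exists_cellMap_fst k₂ h hη hδ rfl rfl n he r hr1 hv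
    refine ⟨θ, fun hin => ?_⟩
    rw [e0, e1] at hin
    have hp : |(σ' - σ) * (D.a n * e)| ≤ 3 / 256 * i := by
      rw [abs_mul, abs_mul, he, mul_one, abs_of_pos (hseg n).pos]
      exact hpert n
    have := abs_le.1 hp
    have := abs_le.1 hv
    obtain ⟨⟨_, _⟩, ⟨_, _⟩⟩ := hin
    simp only [mem_insert_iff, mem_singleton_iff] at hex
    rcases hex with (hex | hex) | (hex | hex)
    · linarith
    · linarith
    · linarith
    · linarith
  · obtain ⟨w, hw, hw1, hw2, hw3⟩ := hL3 hs
    obtain ⟨n, rfl⟩ := hidx w hw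
    have ha := (hseg n).pos
    have f0 := (hseg n).fst_mem 0 (by simp)
    have s0 := (hseg n).snd_mem 0 (by simp)
    simp only [mul_zero, add_zero, mem_Icc] at f0 s0 hw1 hw2 hw3 ha
    have hX : (![D.c₁ n, D.c₂ n] 0 - D.c₁ n) ^ 2 < i ^ 2 / 16 * D.a n ^ 2 := by
      have : 0 < i ^ 2 / 16 * D.a n ^ 2 := mul_pos hη (pow_pos ha 2)
      simpa using this
    have hv : |(![D.c₁ n, D.c₂ n] 1 - D.c₂ n) - σ' * (![D.c₁ n, D.c₂ n] 0 - D.c₁ n)| ≤ i / 32 := by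
      simp; positivity
    have hp : |(σ' - σ) * D.a n| ≤ 3 / 256 * i := by
      rw [abs_mul, abs_of_pos ha]
      exact hpert n
    have := abs_le.1 hp
    refine ⟨![D.c₁ n, D.c₂ n], Fin.forall_fin_two.2 ⟨?_, ?_⟩, ?_, ?_⟩
    · show 0 < D.c₁ n
      linarith
    · show 0 < D.c₂ n
      linarith
    · obtain ⟨θ, e0, e1⟩ := D.exists_cellMap_fst k₂ h hη hδ rfl rfl n (e := -1) (by simp) _ hX hv
      refine ⟨θ, ?_⟩
      rw [e0, e1]
      simp only [Matrix.cons_val_zero, Matrix.cons_val_one, sub_self]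
      constructor <;> linarith
    · obtain ⟨θ, e0, e1⟩ := D.exists_cellMap_fst k₂ h hη hδ rfl rfl n (e := 1) (by simp) _ hX hv
      refine ⟨θ, ?_⟩
      rw [e0, e1]
      simp only [Matrix.cons_val_zero, Matrix.cons_val_one, sub_self]
      rcases hw3 with hw3 | hw3
      · left; linarith
      · right; linarith

namespace IsLiouvillePair

variable {ω₁ ω₂ : ℝ}

theorem fst_ne_zero (h : IsLiouvillePair ω₁ ω₂) : ω₁ ≠ 0 := by
  simpa using h.1 (1, 0) (by simp)

theorem snd_ne_zero (h : IsLiouvillePair ω₁ ω₂) : ω₂ ≠ 0 := by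
  simpa using h.1 (0, 1) (by simp)

theorem irrational (h : IsLiouvillePair ω₁ ω₂) : Irrational (ω₂ / ω₁) := by
  rintro ⟨q, hq⟩
  have hd : (q.den : ℝ) ≠ 0 := by exact_mod_cast q.den_ne_zero
  refine h.1 (-q.num, q.den) (by simp) ?_
  rw [Rat.cast_def, div_eq_div_iff hd h.fst_ne_zero] at hq
  push_cast
  linarith

theorem exists_resonance (h : IsLiouvillePair ω₁ ω₂) {γ : ℝ} (hγ : 0 < γ) {N : ℕ} (hN : 0 < N) :
    ∃ k₁ k₂ : ℤ, 1 ≤ max |(k₁ : ℝ)| |(k₂ : ℝ)| ∧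
      |k₁ * ω₁ + k₂ * ω₂| * max |(k₁ : ℝ)| |(k₂ : ℝ)| ^ N < γ := by
  have h2 := h.2
  simp only [IsDiophantinePair] at h2
  push Not at h2
  obtain ⟨k, hk, hlt⟩ := h2 γ hγ N (by exact_mod_cast hN)
  have hmax : 1 ≤ max |(k.1 : ℝ)| |(k.2 : ℝ)| := by
    rcases ne_or_eq k.1 0 with h1 | h1
    · exact le_max_of_le_left (by exact_mod_cast Int.one_le_abs h1)
    · have h2 : k.2 ≠ 0 := fun h2 => hk (Prod.ext h1 h2)
      exact le_max_of_le_right (by exact_mod_cast Int.one_le_abs h2)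
  refine ⟨k.1, k.2, hmax, ?_⟩
  rwa [Real.rpow_neg (by positivity), Real.rpow_natCast, ← div_eq_mul_inv,
    lt_div_iff₀ (by positivity)] at hlt

theorem exists_resonance_near (h : IsLiouvillePair ω₁ ω₂) {ρ ε C : ℝ} (hρ : 0 < ρ) (hε : 0 < ε)
    (hC : 0 ≤ C) (s : ℕ) : ∃ k₁ k₂ : ℤ, k₁ ≠ 0 ∧ |(k₂ / k₁ : ℝ) - -ω₁ / ω₂| ≤ ρ ∧
      |(k₁ * ω₁ + k₂ * ω₂) / k₁| * (C * max |(k₁ : ℝ)| |(k₂ : ℝ)| ^ s) < ε := by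
  have h2 := h.snd_ne_zero
  have h2' := abs_pos.2 h2
  have hC' : 0 < C + 1 := by linarith
  obtain ⟨k₁, k₂, hm, hk⟩ := h.exists_resonance
    (γ := min |ω₂| (min (ρ * |ω₂|) (ε / (C + 1)))) (by positivity) (N := s + 1) (Nat.succ_pos s)
  set m := max |(k₁ : ℝ)| |(k₂ : ℝ)| with hm'
  set κ := k₁ * ω₁ + k₂ * ω₂ with hκ
  have hm1 : |κ| ≤ |κ| * m ^ (s + 1) :=
    le_mul_of_one_le_right (abs_nonneg _) (one_le_pow₀ hm)
  have b1 := hk.trans_le (min_le_left _ _)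
  have b2 := hk.trans_le ((min_le_right _ _).trans (min_le_left _ _))
  have b3 := hk.trans_le ((min_le_right _ _).trans (min_le_right _ _))
  have hk0 : k₁ ≠ 0 := by
    rintro rfl
    simp only [Int.cast_zero, abs_zero, zero_mul, zero_add] at hm' hκ
    rw [max_eq_right (abs_nonneg _)] at hm'
    have : |ω₂| ≤ |κ| := by
      rw [hκ, abs_mul]
      exact le_mul_of_one_le_left (abs_nonneg _) (hm' ▸ hm)
    linarith
  have hk1 : (k₁ : ℝ) ≠ 0 := by exact_mod_cast hk0
  have hk2 : 1 ≤ |(k₁ : ℝ)| := by exact_mod_cast Int.one_le_abs hk0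
  have hdiv : |κ / k₁| ≤ |κ| := by
    rw [abs_div]
    exact div_le_self (abs_nonneg _) hk2
  refine ⟨k₁, k₂, hk0, ?_, ?_⟩
  · have : (k₂ / k₁ : ℝ) - -ω₁ / ω₂ = κ / k₁ / ω₂ := by
      rw [hκ]; field_simp; ring
    rw [this, abs_div, div_le_iff₀ h2']
    linarith
  · have : m ^ s ≤ m ^ (s + 1) := pow_le_pow_right₀ hm (Nat.le_succ s)
    have hb : |κ| * m ^ (s + 1) * (C + 1) < ε := (lt_div_iff₀ hC').1 b3
    calc |κ / k₁| * (C * m ^ s) ≤ |κ| * (C * m ^ (s + 1)) := by gcongr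
      _ ≤ |κ| * m ^ (s + 1) * (C + 1) := by
        have : 0 ≤ |κ| * m ^ (s + 1) := by positivity
        nlinarith
      _ < ε := hb

end IsLiouvillePair

theorem quadFlow_polarMap (ω₁ ω₂ t : ℝ) (q : Ph 2) :
    quadFlow ω₁ ω₂ t (polarMap q) = polarMap (q.1, ![q.2 0 - ω₁ * t, q.2 1 - ω₂ * t]) := by
  ext j <;> fin_cases j <;> simp [quadFlow, polarMap, Real.cos_sub, Real.sin_sub] <;> ring

theorem continuous_polarMap : Continuous polarMap := by
  unfold polarMap
  fun_prop

theorem exists_nonneg_quadFlow_mem {ω₁ ω₂ : ℝ} (h₁ : ω₁ ≠ 0) (hρ : Irrational (ω₂ / ω₁))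
    {O : Set (Ph 2)} (hO : IsOpen O) {r θ : Fin 2 → ℝ} (θ₀ : Fin 2 → ℝ)
    (h : polarMap (r, θ) ∈ O) : ∃ t, 0 ≤ t ∧ quadFlow ω₁ ω₂ t (polarMap (r, θ₀)) ∈ O := by
  have hc : Continuous fun θ : Fin 2 → ℝ => polarMap (r, θ) :=
    continuous_polarMap.comp (by fun_prop)
  obtain ⟨ε, hε, hball⟩ := Metric.isOpen_iff.1 (hO.preimage hc) θ h
  obtain ⟨t, ht, m₁, m₂, hm₁, hm₂⟩ :=
    exists_nonneg_time_near h₁ hρ (θ₀ 0 - θ 0) (θ₀ 1 - θ 1) hε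
  refine ⟨t, ht, ?_⟩
  rw [quadFlow_polarMap, ← polarMap_add_two_pi _ ![m₁, m₂]]
  refine hball ?_
  rw [mem_ball, dist_pi_lt_iff hε, Fin.forall_fin_two]
  constructor
  · rw [Real.dist_eq, abs_sub_comm]
    convert hm₁ using 2
    simp; ring
  · rw [Real.dist_eq, abs_sub_comm]
    convert hm₂ using 2
    simp; ring

theorem IsCompact.exists_uniform_time {X : Type*} [TopologicalSpace X] {K O : Set X}
    (hK : IsCompact K) (hO : IsOpen O) {F : ℝ → X → X} (hF : ∀ t, Continuous (F t))
    (h : ∀ x ∈ K, ∃ t, 0 ≤ t ∧ F t x ∈ O) :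
    ∃ T : ℝ, ∀ x ∈ K, ∃ t ∈ Icc (0 : ℝ) T, F t x ∈ O := by
  refine hK.induction_on (p := fun S => ∃ T : ℝ, ∀ x ∈ S, ∃ t ∈ Icc (0 : ℝ) T, F t x ∈ O)
    ⟨0, by simp⟩ ?_ ?_ ?_
  · rintro S S' hS ⟨T, hT⟩
    exact ⟨T, fun x hx => hT x (hS hx)⟩
  · rintro S S' ⟨T, hT⟩ ⟨T', hT'⟩
    refine ⟨max T T', fun x hx => ?_⟩
    rcases hx with hx | hx
    · obtain ⟨t, ht, h⟩ := hT x hx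
      exact ⟨t, ⟨ht.1, ht.2.trans (le_max_left _ _)⟩, h⟩
    · obtain ⟨t, ht, h⟩ := hT' x hx
      exact ⟨t, ⟨ht.1, ht.2.trans (le_max_right _ _)⟩, h⟩
  · intro x hx
    obtain ⟨t, ht, hxt⟩ := h x hx
    exact ⟨F t ⁻¹' O, mem_nhdsWithin_of_mem_nhds ((hO.preimage (hF t)).mem_nhds hxt), t,
      fun y hy => ⟨t, ⟨ht, le_rfl⟩, hy⟩⟩

theorem marginM_eq (A : ℝ) : marginM A = (Rtilde A)ᶜ := by
  ext p
  simp only [marginM, Rtilde, mem_union, mem_ofPred_eq, mem_compl_iff, mem_Icc]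
  grind

theorem Rtilde_mono {A B : ℝ} (hA : 0 < A) (h : A ≤ B) : Rtilde A ⊆ Rtilde B := by
  have h' : B⁻¹ ≤ A⁻¹ := inv_anti₀ hA h
  exact fun p hp => ⟨Icc_subset_Icc h' h hp.1, Icc_subset_Icc h' h hp.2⟩

theorem flatOn_of_eventuallyEq_id {U : Ph 2 → Ph 2} {S : Set (Ph 2)}
    (h : ∀ p ∈ S, U =ᶠ[𝓝 p] id) : FlatOn U S := by
  intro p hp k
  have : (fun q => U q - q) =ᶠ[𝓝 p] fun _ => 0 := by
    filter_upwards [h p hp] with q hq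
    simp [hq]
  rw [(Filter.EventuallyEq.iteratedFDeriv ℝ this k).eq_of_nhds]
  simp

theorem isSymplectomorphism_id : IsSymplectomorphism (d := 2) (fun p => p) (fun p => p) where
  smooth := contDiff_id
  smooth_inv := contDiff_id
  left_inv _ := rfl
  right_inv _ := rfl
  sympl p v w := by simp

theorem Rtilde_eq_empty {A : ℝ} (hA0 : 0 < A) (hA : A < 1) : Rtilde A = ∅ := by
  have : 1 < A⁻¹ := (one_lt_inv₀ hA0).2 hA
  refine eq_empty_of_forall_notMem fun p hp => ?_
  have := hp.1.1.trans hp.1.2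
  linarith

/-- The case of a parameter `A < 1`, in which `R̃(A)` is empty. -/
theorem exists_escape_of_lt_one (ω₁ ω₂ : ℝ) {ε : ℝ} (hε : 0 < ε) (s : ℕ) {A : ℝ} (hA0 : 0 < A)
    (hA : A < 1) {V Vinv : Ph 2 → Ph 2} (hV : IsSymplectomorphism V Vinv) :
    ∃ (U Uinv : Ph 2 → Ph 2) (T : ℝ), 0 < T ∧
      IsSymplectomorphism U Uinv ∧
      FlatOn U ({q : Ph 2 | actJ 0 q = 0} ∪ {q : Ph 2 | actJ 1 q = 0}) ∧
      (∀ p ∉ Rtilde (2 * A), U p = p) ∧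
      (∀ z : Ph 2, ∀ k ≤ s, ‖iteratedFDeriv ℝ k
        (fun w => quadHam ω₁ ω₂ (Uinv (Vinv w)) - quadHam ω₁ ω₂ (Vinv w)) z‖ < ε) ∧
      ∃ Φ : ℝ → Ph 2 → Ph 2, IsGlobalFlow (fun w => quadHam ω₁ ω₂ (Uinv (Vinv w))) Φ ∧
        (∀ P ∈ Rtilde A, ∃ t ∈ Icc (0:ℝ) T, Φ t P ∈ marginM A) ∧
        (ω₁ * ω₂ < 0 → ∃ p' : Ph 2,
          (∃ t ∈ Icc (0:ℝ) T,
            actJ 0 (Φ t p') < 2 * A⁻¹ ∧ actJ 1 (Φ t p') < 2 * A⁻¹) ∧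
          (∃ t ∈ Icc (0:ℝ) T, A < actJ 0 (Φ t p') ∨ A < actJ 1 (Φ t p'))) := by
  have hflow := IsGlobalFlow.conj hV ((contDiff_quadHam ω₁ ω₂).differentiable (by simp))
    (isGlobalFlow_quadFlow ω₁ ω₂)
  refine ⟨fun p => p, fun p => p, 1, one_pos, isSymplectomorphism_id,
    flatOn_of_eventuallyEq_id fun p _ => EventuallyEq.rfl, fun _ _ => rfl, fun z k _ => ?_,
    _, hflow, fun P hP => ?_, fun _ => ?_⟩
  · simpa using hε
  · simp [Rtilde_eq_empty hA0 hA] at hP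
  · have h1 : 1 < A⁻¹ := (one_lt_inv₀ hA0).2 hA
    have hp : ∀ j, actJ j (polarMap (fun _ => A⁻¹, 0)) = A⁻¹ := fun j =>
      actJ_polarMap (q := (fun _ => A⁻¹, 0)) (j := j) (inv_nonneg.2 hA0.le)
    have h0 : V (quadFlow ω₁ ω₂ 0 (Vinv (polarMap (fun _ => A⁻¹, 0)))) =
        polarMap (fun _ => A⁻¹, 0) := hflow.1 _
    refine ⟨polarMap (fun _ => A⁻¹, 0), ⟨0, by simp, ?_⟩, 0, by simp, .inl ?_⟩
    · rw [h0, hp, hp]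
      constructor <;> linarith
    · rw [h0, hp]
      linarith

/-- The case `1 ≤ A`. -/
theorem exists_escape_of_one_le {ω₁ ω₂ : ℝ} (hω : IsLiouvillePair ω₁ ω₂) {ε : ℝ} (hε : 0 < ε)
    (s : ℕ) {A : ℝ} (hA : 1 ≤ A) {V Vinv : Ph 2 → Ph 2} (hV : IsSymplectomorphism V Vinv)
    (hVid : ∀ p ∉ Rtilde A, V p = p) :
    ∃ (U Uinv : Ph 2 → Ph 2) (T : ℝ), 0 < T ∧
      IsSymplectomorphism U Uinv ∧
      FlatOn U ({q : Ph 2 | actJ 0 q = 0} ∪ {q : Ph 2 | actJ 1 q = 0}) ∧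
      (∀ p ∉ Rtilde (2 * A), U p = p) ∧
      (∀ z : Ph 2, ∀ k ≤ s, ‖iteratedFDeriv ℝ k
        (fun w => quadHam ω₁ ω₂ (Uinv (Vinv w)) - quadHam ω₁ ω₂ (Vinv w)) z‖ < ε) ∧
      ∃ Φ : ℝ → Ph 2 → Ph 2, IsGlobalFlow (fun w => quadHam ω₁ ω₂ (Uinv (Vinv w))) Φ ∧
        (∀ P ∈ Rtilde A, ∃ t ∈ Icc (0:ℝ) T, Φ t P ∈ marginM A) ∧
        (ω₁ * ω₂ < 0 → ∃ p' : Ph 2,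
          (∃ t ∈ Icc (0:ℝ) T,
            actJ 0 (Φ t p') < 2 * A⁻¹ ∧ actJ 1 (Φ t p') < 2 * A⁻¹) ∧
          (∃ t ∈ Icc (0:ℝ) T, A < actJ 0 (Φ t p') ∨ A < actJ 1 (Φ t p'))) := by
  have h1 := hω.fst_ne_zero
  have h2 := hω.snd_ne_zero
  have hA0 : 0 < A := by linarith
  have hAi : 0 < A⁻¹ := inv_pos.2 hA0
  have hB : 0 < 2 * A := by linarith
  obtain ⟨D, ρ, hρ, hD⟩ := exists_cellData hA (σ := -ω₁ / ω₂) (div_ne_zero (neg_ne_zero.2 h1) h2)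
  obtain ⟨C, hC, hbound⟩ := D.exists_norm_iteratedFDeriv_actJ_le hB hV (-1) s
  obtain ⟨k₁, k₂, hk, hkρ, hkε⟩ := hω.exists_resonance_near hρ hε hC s
  obtain ⟨hbox, hexit, hcorner⟩ := hD k₁ k₂ hk hkρ
  have hF := D.isLiftable_cellMap hk hbox 1
  have hG := D.isLiftable_cellMap hk hbox (-1)
  have hU := isSymplectomorphism_polarLift hB hF hG (D.isSymplectomorphism_cellMap hk 1)
  set U := polarLift (2 * A) (D.cellMap k₁ k₂ 1) with hUdef
  set Uinv := polarLift (2 * A) (D.cellMap k₁ k₂ (-1)) with hUinv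
  have hW := hV.comp hU
  have hflow := IsGlobalFlow.conj hW ((contDiff_quadHam ω₁ ω₂).differentiable (by simp))
    (isGlobalFlow_quadFlow ω₁ ω₂)
  have hWc : Continuous fun p => V (U p) := hW.smooth.continuous
  have hUp {q : Ph 2} (hq : q ∈ posAct) : U (polarMap q) = polarMap (D.cellMap k₁ k₂ 1 q) :=
    polarLift_polarMap hF hq
  have hpos {q : Ph 2} (hq : q ∈ posAct) : D.cellMap k₁ k₂ 1 q ∈ posAct := hF.mem_posAct hB hq
  have hact {q : Ph 2} (hq : q ∈ posAct) (j : Fin 2) :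
      actJ j (U (polarMap q)) = (D.cellMap k₁ k₂ 1 q).1 j := by
    rw [hUp hq]
    exact actJ_polarMap (hpos hq j).le
  have hexit' (r : Fin 2 → ℝ) : ∃ θ, ¬ ((D.cellMap k₁ k₂ 1 (r, θ)).1 0 ∈ Icc A⁻¹ A ∧
      (D.cellMap k₁ k₂ 1 (r, θ)).1 1 ∈ Icc A⁻¹ A) := by
    by_cases hr : r 0 ∈ Icc A⁻¹ A ∧ r 1 ∈ Icc A⁻¹ A
    · exact hexit r hr.1 hr.2
    · obtain ⟨θ, hθ⟩ := D.exists_cellMap_eq_self k₂ hk 1 r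
      exact ⟨θ, by rwa [hθ]⟩
  have hopen : IsOpen (marginM A) := marginM_eq A ▸ (isClosed_Rtilde A).isOpen_compl
  have hescape : ∀ P ∈ Rtilde A, ∃ t, 0 ≤ t ∧
      V (U (quadFlow ω₁ ω₂ t (Uinv (Vinv P)))) ∈ marginM A := by
    intro P hP
    set p := Uinv (Vinv P) with hp
    have hPp : V (U p) = P := hW.right_inv P
    have hpB : p ∈ Rtilde (2 * A) := by
      by_contra h
      have hUpp : U p = p := polarLift_of_notMem h
      have hpA : p ∉ Rtilde A := fun h' => h (Rtilde_mono hA0 (by linarith) h')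
      rw [hUpp, hVid p hpA] at hPp
      exact hpA (hPp ▸ hP)
    obtain ⟨⟨r, θ₀⟩, hq, hqp⟩ := exists_polarMap_eq hB hpB
    obtain ⟨θ, hθ⟩ := hexit' r
    have hq' : (r, θ) ∈ posAct := hq
    rw [← hqp]
    refine exists_nonneg_quadFlow_mem h1 hω.irrational (hopen.preimage hWc) (θ := θ) θ₀ ?_
    have hn : U (polarMap (r, θ)) ∉ Rtilde A := by
      rw [hUp hq', polarMap_mem_Rtilde (hpos hq')]
      exact hθ
    rw [mem_preimage, hVid _ hn, marginM_eq]
    exact hn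
  obtain ⟨T, hT⟩ := (isCompact_Rtilde A).exists_uniform_time hopen
    (F := fun t P => V (U (quadFlow ω₁ ω₂ t (Uinv (Vinv P)))))
    (fun t => hWc.comp (((continuous_quadFlow ω₁ ω₂).comp
      (Continuous.prodMk_right t)).comp hW.smooth_inv.continuous)) hescape
  have hcorner' : ∃ T' : ℝ, ω₁ * ω₂ < 0 → ∃ p' : Ph 2,
      (∃ t ∈ Icc (0:ℝ) T', actJ 0 (V (U (quadFlow ω₁ ω₂ t (Uinv (Vinv p'))))) < 2 * A⁻¹ ∧
        actJ 1 (V (U (quadFlow ω₁ ω₂ t (Uinv (Vinv p'))))) < 2 * A⁻¹) ∧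
      (∃ t ∈ Icc (0:ℝ) T', A < actJ 0 (V (U (quadFlow ω₁ ω₂ t (Uinv (Vinv p'))))) ∨
        A < actJ 1 (V (U (quadFlow ω₁ ω₂ t (Uinv (Vinv p')))))) := by
    by_cases hneg : ω₁ * ω₂ < 0
    · have hσ : 0 < -ω₁ / ω₂ := by
        rw [← mul_div_mul_right _ _ h2]
        exact div_pos (by linarith) (mul_self_pos.2 h2)
      obtain ⟨r, hr, ⟨θ, hθ0, hθ1⟩, θ', hθ'⟩ := hcorner hσ
      have hr' (θ : Fin 2 → ℝ) : (r, θ) ∈ posAct := hr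
      have hc (j : Fin 2) : Continuous fun p => actJ j (V (U p)) :=
        (contDiff_actJ j).continuous.comp hWc
      have hn : U (polarMap (r, θ)) ∉ Rtilde A := fun hin => by
        have := hin.1.1
        rw [hact (hr' θ)] at this
        linarith
      have hn' : U (polarMap (r, θ')) ∉ Rtilde A := fun hin => by
        have h3 := hin.1.2
        have h4 := hin.2.2
        rw [hact (hr' θ')] at h3 h4
        rcases hθ' with h | h <;> linarith
      obtain ⟨t, ht, hlt⟩ := exists_nonneg_quadFlow_mem h1 hω.irrational
        ((isOpen_lt (hc 0) continuous_const).inter (isOpen_lt (hc 1) continuous_const))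
        (O := {p | actJ 0 (V (U p)) < 2 * A⁻¹} ∩ {p | actJ 1 (V (U p)) < 2 * A⁻¹})
        (r := r) (θ := θ) 0 (by
          simp only [mem_inter_iff, mem_ofPred_eq]
          rw [hVid _ hn, hact (hr' θ), hact (hr' θ)]
          constructor <;> linarith)
      obtain ⟨t', ht', hlt'⟩ := exists_nonneg_quadFlow_mem h1 hω.irrational
        ((isOpen_lt continuous_const (hc 0)).union (isOpen_lt continuous_const (hc 1)))
        (O := {p | A < actJ 0 (V (U p))} ∪ {p | A < actJ 1 (V (U p))})
        (r := r) (θ := θ') 0 (by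
          simp only [mem_union, mem_ofPred_eq]
          rw [hVid _ hn', hact (hr' θ'), hact (hr' θ')]
          exact hθ')
      refine ⟨max t t', fun _ => ⟨V (U (polarMap (r, 0))), ⟨t, ⟨ht, le_max_left _ _⟩, ?_⟩,
        t', ⟨ht', le_max_right _ _⟩, ?_⟩⟩
      · rw [show Uinv (Vinv (V (U (polarMap (r, 0))))) = polarMap (r, 0) from hW.left_inv _]
        exact hlt
      · rw [show Uinv (Vinv (V (U (polarMap (r, 0))))) = polarMap (r, 0) from hW.left_inv _]
        exact hlt'
    · exact ⟨0, fun h => absurd h hneg⟩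
  obtain ⟨T', hT'⟩ := hcorner'
  have hTT : T ≤ max 1 (max T T') := (le_max_left _ _).trans (le_max_right _ _)
  have hTT' : T' ≤ max 1 (max T T') := (le_max_right _ _).trans (le_max_right _ _)
  refine ⟨U, Uinv, max 1 (max T T'), by positivity, hU, ?_, fun p hp => polarLift_of_notMem hp,
    fun z m hm => ?_, _, hflow, fun P hP => ?_, fun hneg => ?_⟩
  · refine flatOn_of_eventuallyEq_id fun p hp => polarLift_eventuallyEq_id fun hin => ?_
    have hBi : 0 < (2 * A)⁻¹ := inv_pos.2 hB
    rcases hp with hp | hp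
    · have := hin.1.1
      rw [show actJ 0 p = 0 from hp] at this
      linarith
    · have := hin.2.1
      rw [show actJ 1 p = 0 from hp] at this
      linarith
  · have hfun : (fun w => quadHam ω₁ ω₂ (Uinv (Vinv w)) - quadHam ω₁ ω₂ (Vinv w)) =
        fun w => ((k₁ * ω₁ + k₂ * ω₂) / k₁) • (actJ 0 (Uinv (Vinv w)) - actJ 0 (Vinv w)) := by
      funext w
      exact D.quadHam_polarLift_cellMap hB hk hbox ω₁ ω₂ (-1) (Vinv w)
    have hsm : ContDiff ℝ (⊤ : ℕ∞) fun w => actJ 0 (Uinv (Vinv w)) - actJ 0 (Vinv w) :=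
      ((contDiff_actJ 0).comp hW.smooth_inv).sub ((contDiff_actJ 0).comp hV.smooth_inv)
    rw [hfun, iteratedFDeriv_const_smul_apply'
      (hsm.contDiffAt.of_le (by exact_mod_cast le_top)), norm_smul, Real.norm_eq_abs]
    refine lt_of_le_of_lt ?_ hkε
    gcongr
    exact hbound k₁ k₂ hk hbox z m hm
  · obtain ⟨t, ht, h⟩ := hT P hP
    exact ⟨t, ⟨ht.1, ht.2.trans hTT⟩, h⟩
  · obtain ⟨p', ⟨t, ht, h⟩, t', ht', h'⟩ := hT' hneg
    exact ⟨p', ⟨t, ⟨ht.1, ht.2.trans hTT'⟩, h⟩, t', ⟨ht'.1, ht'.2.trans hTT'⟩, h'⟩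

theorem statement10 (ω₁ ω₂ : ℝ) (hω : IsLiouvillePair ω₁ ω₂)
    (H₀ : Ph 2 → ℝ) (hH₀ : H₀ = fun p => ω₁ * actJ 0 p + ω₂ * actJ 1 p)
    (ε : ℝ) (hε : 0 < ε) (s : ℕ) (A₀ : ℝ) (hA₀ : 0 < A₀)
    (V Vinv : Ph 2 → Ph 2) (hV : IsSymplectomorphism V Vinv)
    (hVid : ∀ p ∉ Rtilde A₀, V p = p)
    (A : ℝ) (hA : A₀ < A) :
    ∃ (U Uinv : Ph 2 → Ph 2) (T : ℝ), 0 < T ∧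
      IsSymplectomorphism U Uinv ∧
      FlatOn U ({q : Ph 2 | actJ 0 q = 0} ∪ {q : Ph 2 | actJ 1 q = 0}) ∧
      (∀ p ∉ Rtilde (2 * A), U p = p) ∧
      (∀ z : Ph 2, ∀ k ≤ s,
        ‖iteratedFDeriv ℝ k (fun w => H₀ (Uinv (Vinv w)) - H₀ (Vinv w)) z‖ < ε) ∧
      ∃ Φ : ℝ → Ph 2 → Ph 2, IsGlobalFlow (fun w => H₀ (Uinv (Vinv w))) Φ ∧
        (∀ P ∈ Rtilde A, ∃ t ∈ Icc (0:ℝ) T, Φ t P ∈ marginM A) ∧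
        (ω₁ * ω₂ < 0 → ∃ p' : Ph 2,
          (∃ t ∈ Icc (0:ℝ) T,
            actJ 0 (Φ t p') < 2 * A⁻¹ ∧ actJ 1 (Φ t p') < 2 * A⁻¹) ∧
          (∃ t ∈ Icc (0:ℝ) T, A < actJ 0 (Φ t p') ∨ A < actJ 1 (Φ t p'))) := by
  subst hH₀
  have hVid' : ∀ p ∉ Rtilde A, V p = p := fun p hp =>
    hVid p fun h => hp (Rtilde_mono hA₀ hA.le h)
  rcases lt_or_ge A 1 with h | h
  · exact exists_escape_of_lt_one ω₁ ω₂ hε s (hA₀.trans hA) h hV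
  · exact exists_escape_of_one_le hω hε s h hV hVid'
end
end
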